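/- Let ξ ∈ Cr(X). For any two spherical residues x, y ∈ Res(X), there exists z ∈ Res(X) such that Q(z,ξ) ⊆ Q(x,ξ) ∩ Q(y,ξ); in particular, any two combinatorial sectors pointing towards the same point ξ of the maximal combinatorial bordification have non-empty intersection and contain a common subsector (the family of sectors pointing to ξ is filtering). -/

import Mathlib

open Filter Topology

noncomputable section

variable {B : Type} {W : Type} [Group W] {M : CoxeterMatrix B}

/-- The subset `I` of the simple reflections is of *spherical type* if the standard
parabolic subgroup `W_I` it generates is finite. -/
def SphType (cs : CoxeterSystem M W) (I : Set B) : Prop :=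
  ((Subgroup.closure (cs.simple '' I) : Subgroup W) : Set W).Finite

/-- A building of type `(W,S)`, in the chamber-system (`W`-metric) approach:
a nonempty set of chambers with a Weyl-group-valued distance function `delta`. -/
structure Bldg (cs : CoxeterSystem M W) where
  Chamber : Type
  chamber_nonempty : Nonempty Chamber
  delta : Chamber → Chamber → W
  delta_eq_one_iff : ∀ C D, delta C D = 1 ↔ C = D
  delta_mem_pair : ∀ C D E (i : B), delta D E = cs.simple i →
    delta C E = delta C D * cs.simple i ∨ delta C E = delta C D
  delta_eq_of_length : ∀ C D E (i : B), delta D E = cs.simple i →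
    cs.length (delta C D * cs.simple i) = cs.length (delta C D) + 1 →
    delta C E = delta C D * cs.simple i
  exists_delta : ∀ C D (i : B), ∃ E, delta D E = cs.simple i ∧
    delta C E = delta C D * cs.simple i

namespace Bldg

variable {cs : CoxeterSystem M W} (X : Bldg cs)

instance : Nonempty X.Chamber := X.chamber_nonempty

instance : TopologicalSpace X.Chamber := ⊥
instance : DiscreteTopology X.Chamber := ⟨rfl⟩

/-- The gallery distance between two chambers. -/
def gdist (C D : X.Chamber) : ℕ := cs.length (X.delta C D)

/-- The `I`-residue of the chamber `C`. -/
def residue (I : Set B) (C : X.Chamber) : Set X.Chamber :=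
  {D | X.delta C D ∈ Subgroup.closure (cs.simple '' I)}

/-- `R` is a spherical residue. -/
def IsSphResidue (R : Set X.Chamber) : Prop :=
  ∃ (I : Set B) (C : X.Chamber), SphType cs I ∧ R = X.residue I C

/-- `R` is a panel, i.e. an `{s}`-residue. -/
def IsPanel (R : Set X.Chamber) : Prop :=
  ∃ (i : B) (C : X.Chamber), R = X.residue {i} C

/-- The set `Res(X)` of spherical residues of `X`. -/
def Res : Type := {R : Set X.Chamber // X.IsSphResidue R}

/-- The set of panels of `X`. -/
def Panel : Type := {R : Set X.Chamber // X.IsPanel R}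

instance : Nonempty X.Res := by
  obtain ⟨C⟩ := X.chamber_nonempty
  exact ⟨⟨X.residue ∅ C, ∅, C, by simp [SphType], rfl⟩⟩

instance : TopologicalSpace X.Res := ⊥
instance : DiscreteTopology X.Res := ⟨rfl⟩

/-- `R₁ ≤ R₂` : the spherical residue `R₂` contains `R₁`, i.e. `R₂ ⊆ R₁` as
sets of chambers. -/
def leRes (R₁ R₂ : X.Res) : Prop := R₂.1 ⊆ R₁.1

/-- The star `St(σ)` of a spherical residue. -/
def star (σ : X.Res) : Set X.Res := {τ | X.leRes σ τ}

/-- The gate (combinatorial projection) of the chamber `C` onto the residue `R` :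
the unique chamber of `R` through which pass minimal galleries from `C` to any
chamber of `R`. -/
def gate (R : Set X.Chamber) (C : X.Chamber) : X.Chamber :=
  Classical.epsilon fun D => D ∈ R ∧ ∀ E ∈ R, X.gdist C E = X.gdist C D + X.gdist D E

/-- The combinatorial projection of the residue `T` onto the residue `R`,
as a set of chambers. -/
def projSet (R T : Set X.Chamber) : Set X.Chamber := X.gate R '' T

/-- The combinatorial projection `proj_R(T)` of the spherical residue `T` onto
the spherical residue `R`, as a spherical residue. -/
def projRes (R T : X.Res) : X.Res :=
  Classical.epsilon fun U : X.Res => U.1 = X.projSet R.1 T.1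

/-- The map `proj_r : Res(X) → ∏_σ St(σ)` underlying the maximal combinatorial
bordification. -/
def projr (R : X.Res) : X.Res → X.Res := fun σ => X.projRes σ R

/-- The maximal combinatorial bordification `Cr(X)`: the closure of the image
of `proj_r`, each factor of the product being discrete. -/
def Cr : Set (X.Res → X.Res) := closure (Set.range X.projr)

/-- The map `proj_c : ch(X) → ∏_{σ panel} St(σ)` underlying the minimal
combinatorial bordification. -/
def projc (C : X.Chamber) : X.Panel → X.Chamber := fun σ => X.gate σ.1 C

/-- The minimal combinatorial bordification `Cc(X)`. -/
def Cc : Set (X.Panel → X.Chamber) := closure (Set.range X.projc)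

/-- A set of spherical residues is closed if it contains, with any residue,
all residues that it contains (in the order `leRes`). -/
def ClosedResSet (𝓡 : Set X.Res) : Prop :=
  ∀ R₁ R₂ : X.Res, X.leRes R₁ R₂ → R₂ ∈ 𝓡 → R₁ ∈ 𝓡

/-- A set of spherical residues is convex if it is closed and stable under
combinatorial projections. -/
def ConvexResSet (𝓡 : Set X.Res) : Prop :=
  X.ClosedResSet 𝓡 ∧ ∀ R₁ ∈ 𝓡, ∀ R₂ ∈ 𝓡, X.projRes R₁ R₂ ∈ 𝓡

/-- The closure of a set of spherical residues. -/
def resClosure (𝓡 : Set X.Res) : Set X.Res := ⋂₀ {𝓢 | X.ClosedResSet 𝓢 ∧ 𝓡 ⊆ 𝓢}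

/-- The convex hull of a set of spherical residues. -/
def convHull (𝓡 : Set X.Res) : Set X.Res := ⋂₀ {𝓢 | X.ConvexResSet 𝓢 ∧ 𝓡 ⊆ 𝓢}

/-- The convex hull `Conv(R₁,R₂)` of two spherical residues. -/
def conv2 (R₁ R₂ : X.Res) : Set X.Res := X.convHull {R₁, R₂}

/-- `α : W → ch(X)` is an apartment map: an isometric embedding of the Coxeter
complex. -/
def IsApartMap (α : W → X.Chamber) : Prop :=
  Function.Injective α ∧ ∀ v w : W, X.delta (α v) (α w) = v⁻¹ * w

/-- `A` is an apartment of `X`. -/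
def IsApartment (A : Set X.Chamber) : Prop :=
  ∃ α : W → X.Chamber, X.IsApartMap α ∧ A = Set.range α

/-- The residue `R` lies in the apartment `A`. -/
def LiesIn (R : X.Res) (A : Set X.Chamber) : Prop := (R.1 ∩ A).Nonempty

/-- `φ` is a root (half-apartment) of the apartment `A`. -/
def IsRootOf (A φ : Set X.Chamber) : Prop :=
  ∃ α : W → X.Chamber, X.IsApartMap α ∧ A = Set.range α ∧
    ∃ t : W, cs.IsReflection t ∧ φ = α '' {v : W | cs.length v < cs.length (t * v)}

/-- The residue `R` is contained in the root `φ` of the apartment `A`. -/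
def ContainedInRoot (R : X.Res) (A φ : Set X.Chamber) : Prop := R.1 ∩ A ⊆ φ

/-- `Φ_A(R₁,R₂)`: the set of roots of `A` containing `R₁` but not `R₂`. -/
def PhiSep (A : Set X.Chamber) (R₁ R₂ : X.Res) : Set (Set X.Chamber) :=
  {φ | X.IsRootOf A φ ∧ X.ContainedInRoot R₁ A φ ∧ ¬ X.ContainedInRoot R₂ A φ}

/-- A choice of apartment in which both `R₁` and `R₂` lie. -/
def chooseApt (R₁ R₂ : X.Res) : Set X.Chamber :=
  Classical.epsilon fun A : Set X.Chamber => X.IsApartment A ∧ X.LiesIn R₁ A ∧ X.LiesIn R₂ A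

/-- The root-distance between two spherical residues:
`d(R₁,R₂) = ½|Φ_A(R₁,R₂)| + ½|Φ_A(R₂,R₁)|` for an apartment `A` containing both. -/
def rootDist (R₁ R₂ : X.Res) : ℝ :=
  (((X.PhiSep (X.chooseApt R₁ R₂) R₁ R₂).ncard +
    (X.PhiSep (X.chooseApt R₁ R₂) R₂ R₁).ncard : ℕ) : ℝ) / 2

/-- The interval `[R₁,R₂]` determined by two spherical residues. -/
def interval (R₁ R₂ : X.Res) : Set X.Res :=
  {σ | X.rootDist R₁ R₂ = X.rootDist R₁ σ + X.rootDist σ R₂}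

/-- The retraction onto the apartment given by the apartment map `α`, centred at
the chamber `α 1`. -/
def retr (α : W → X.Chamber) (D : X.Chamber) : X.Chamber := α (X.delta (α 1) D)

/-- The retraction onto an apartment, acting on spherical residues: it maps the
`I`-residue of a chamber `D` to the `I`-residue of the retracted chamber. -/
def retrRes (α : W → X.Chamber) (R : X.Res) : X.Res :=
  Classical.epsilon fun T : X.Res =>
    ∃ (I : Set B) (D : X.Chamber), R.1 = X.residue I D ∧ T.1 = X.residue I (X.retr α D)

/-- The sequence `(R_n)` of spherical residues converges to `ξ` in the maximal
combinatorial bordification. -/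
def ConvSeq (ξ : X.Res → X.Res) (R : ℕ → X.Res) : Prop :=
  Tendsto (fun n => X.projr (R n)) atTop (nhds ξ)

/-- `Q(x, (R_n)) = ⋃_k ⋂_{n ≥ k} Conv(x, R_n)`. -/
def Qseq (x : X.Res) (R : ℕ → X.Res) : Set X.Res :=
  ⋃ k : ℕ, ⋂ n : ℕ, ⋂ _ : k ≤ n, X.conv2 x (R n)

/-- The combinatorial sector `Q(x,ξ)` based at `x` and pointing towards `ξ`. -/
def Qsector (x : X.Res) (ξ : X.Res → X.Res) : Set X.Res :=
  X.Qseq x (Classical.epsilon (X.ConvSeq ξ))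

/-- `Φ_A(ξ)`: the set of roots of the apartment `A` (with apartment map `α`) in
which every sequence of residues converging to `ξ`, retracted to `A`, eventually
lies. -/
def PhiXi (A : Set X.Chamber) (α : W → X.Chamber) (ξ : X.Res → X.Res) :
    Set (Set X.Chamber) :=
  {φ | X.IsRootOf A φ ∧ ∀ R : ℕ → X.Res, X.ConvSeq ξ R →
    ∃ N : ℕ, ∀ n > N, X.ContainedInRoot (X.retrRes α (R n)) A φ}

/-- `Φ_A(x)`: the set of roots of `A` containing the residue `x`. -/
def PhiRes (A : Set X.Chamber) (x : X.Res) : Set (Set X.Chamber) :=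
  {φ | X.IsRootOf A φ ∧ X.ContainedInRoot x A φ}

/-- The spherical residue `x` is a chamber (an `∅`-residue). -/
def IsChamberRes (x : X.Res) : Prop :=
  ∃ C : X.Chamber, x.1 = X.residue (∅ : Set B) C

/-- The automorphism group of the building: all permutations of the chambers
preserving the Weyl distance. -/
def autGroup : Subgroup (Equiv.Perm X.Chamber) where
  carrier := {g | ∀ C D : X.Chamber, X.delta (g C) (g D) = X.delta C D}
  one_mem' := by intro C D; simp
  mul_mem' := by
    intro a b ha hb C D
    simp only [Equiv.Perm.mul_apply]
    rw [ha, hb]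
  inv_mem' := by
    intro a ha C D
    have := ha (a⁻¹ C) (a⁻¹ D)
    simpa using this.symm

/-- `Aut(X)` as a type. -/
abbrev Aut : Type := ↥X.autGroup

/-- The topology of pointwise convergence on `Aut(X)` (the chamber set being
discrete). -/
instance : TopologicalSpace X.Aut :=
  TopologicalSpace.induced
    (fun g : X.Aut => ((g : Equiv.Perm X.Chamber) : X.Chamber → X.Chamber)) inferInstance

/-- The action of an automorphism on spherical residues. -/
def actRes (g : X.Aut) (R : X.Res) : X.Res :=
  Classical.epsilon fun T : X.Res => T.1 = (g : Equiv.Perm X.Chamber) '' R.1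

/-- The action of an automorphism on panels. -/
def actPanel (g : X.Aut) (σ : X.Panel) : X.Panel :=
  haveI : Nonempty X.Panel := ⟨σ⟩
  Classical.epsilon fun τ : X.Panel => τ.1 = (g : Equiv.Perm X.Chamber) '' σ.1

/-- The action of `Aut(X)` on the maximal combinatorial bordification:
`(g·f)(σ) = g·f(g⁻¹σ)`. -/
def actCr (g : X.Aut) (f : X.Res → X.Res) : X.Res → X.Res :=
  fun σ => X.actRes g (f (X.actRes g⁻¹ σ))

/-- The action of `Aut(X)` on the minimal combinatorial bordification. -/
def actCc (g : X.Aut) (f : X.Panel → X.Chamber) : X.Panel → X.Chamber :=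
  fun σ => (g : Equiv.Perm X.Chamber) (f (X.actPanel g⁻¹ σ))

/-- The building is locally finite: `S` is finite and panels are finite. -/
def LocallyFinite : Prop :=
  Finite B ∧ ∀ R : Set X.Chamber, X.IsPanel R → R.Finite

/-- The building is thick: every panel contains at least three chambers. -/
def Thick : Prop := ∀ R : Set X.Chamber, X.IsPanel R → 3 ≤ R.ncard

/-- The subgroup `G ≤ Aut(X)` acts strongly transitively: transitively on pairs
`(C, A)` of a chamber contained in an apartment. -/
def StronglyTransitive (G : Subgroup X.Aut) : Prop :=
  ∀ (C C' : X.Chamber) (A A' : Set X.Chamber),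
    X.IsApartment A → C ∈ A → X.IsApartment A' → C' ∈ A' →
    ∃ g ∈ G, (g : Equiv.Perm X.Chamber) C = C' ∧ (g : Equiv.Perm X.Chamber) '' A = A'

end Bldg

/-- A topological group is amenable if there is a left-invariant mean on the
space of bounded continuous real-valued functions on it. -/
def IsAmenableGroup (H : Type*) [Group H] [TopologicalSpace H] : Prop :=
  ∃ m : BoundedContinuousFunction H ℝ →ₗ[ℝ] ℝ,
    m 1 = 1 ∧ (∀ f : BoundedContinuousFunction H ℝ, (∀ x, 0 ≤ f x) → 0 ≤ m f) ∧
    ∀ (g : H) (f₁ f₂ : BoundedContinuousFunction H ℝ),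
      (∀ x, f₂ x = f₁ (g * x)) → m f₂ = m f₁

/-- A subset `K` of a topological group is topologically locally finite if every
finite subset of `K` generates a subgroup with compact closure. -/
def IsTLFSet {H : Type*} [Group H] [TopologicalSpace H] (K : Set H) : Prop :=
  ∀ s : Finset H, (s : Set H) ⊆ K →
    IsCompact (closure ((Subgroup.closure (s : Set H) : Subgroup H) : Set H))

/-- The space of closed subgroups of a topological group. -/
def ChabautySpace (H : Type*) [Group H] [TopologicalSpace H] : Type _ :=
  {K : Subgroup H // IsClosed (K : Set H)}

instance {H : Type*} [Group H] [TopologicalSpace H] : Nonempty (ChabautySpace H) :=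
  ⟨⟨⊤, by rw [Subgroup.coe_top]; exact isClosed_univ⟩⟩

/-- The Chabauty topology on the space of closed subgroups. -/
instance {H : Type*} [Group H] [TopologicalSpace H] : TopologicalSpace (ChabautySpace H) :=
  TopologicalSpace.generateFrom
    ({s | ∃ K : Set H, IsCompact K ∧ s = {L : ChabautySpace H | (L.1 : Set H) ∩ K = ∅}} ∪
     {s | ∃ U : Set H, IsOpen U ∧ s = {L : ChabautySpace H | ((L.1 : Set H) ∩ U).Nonempty}})

namespace Bldg

variable {cs : CoxeterSystem M W} (X : Bldg cs)

/-- The stabiliser in `G` of a spherical residue, as a set. -/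
def gstab (G : Subgroup X.Aut) (R : X.Res) : Set ↥G :=
  {g : ↥G | X.actRes (g : X.Aut) R = R}

/-- The stabiliser in `G` of a spherical residue, as a closed subgroup of `G`. -/
def gstabC (G : Subgroup X.Aut) (R : X.Res) : ChabautySpace ↥G :=
  Classical.epsilon fun L : ChabautySpace ↥G => (L.1 : Set ↥G) = X.gstab G R

/-- `D_ξ`: the union over `x ∈ Res(X)` of the pointwise fixators in `G` of the
combinatorial sectors `Q(x,ξ)`. -/
def gfixSector (G : Subgroup X.Aut) (ξ : X.Res → X.Res) : Set ↥G :=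
  {g : ↥G | ∃ x : X.Res, ∀ R ∈ X.Qsector x ξ, X.actRes (g : X.Aut) R = R}

/-- `D_ξ` as a closed subgroup of `G` (an element of the Chabauty space). -/
def DxiC (G : Subgroup X.Aut) (ξ : X.Res → X.Res) : ChabautySpace ↥G :=
  Classical.epsilon fun L : ChabautySpace ↥G => (L.1 : Set ↥G) = X.gfixSector G ξ

/-- The set of periodic elements of the stabiliser `G_ξ`. -/
def periodicStab (G : Subgroup X.Aut) (ξ : X.Res → X.Res) : Set ↥G :=
  {g : ↥G | X.actCr (g : X.Aut) ξ = ξ ∧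
    IsCompact (closure ((Subgroup.zpowers g : Subgroup ↥G) : Set ↥G))}

/-- The horofunction compactification of the chamber graph, with base point `y₀`. -/
def horoCh (y₀ : X.Chamber) : Set (X.Chamber → ℝ) :=
  closure (Set.range fun C : X.Chamber =>
    fun y : X.Chamber => (X.gdist C y : ℝ) - (X.gdist C y₀ : ℝ))

/-- The horofunction compactification of `(Res(X), root-distance)`, with base
point `z₀`. -/
def horoRes (z₀ : X.Res) : Set (X.Res → ℝ) :=
  closure (Set.range fun R : X.Res =>
    fun y : X.Res => X.rootDist R y - X.rootDist R z₀)

/-- The action of `Aut(X)` on horofunctions of the chamber graph. -/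
def actHoroCh (y₀ : X.Chamber) (g : X.Aut) (h : X.Chamber → ℝ) : X.Chamber → ℝ :=
  fun y => h (((g⁻¹ : X.Aut) : Equiv.Perm X.Chamber) y) -
    h (((g⁻¹ : X.Aut) : Equiv.Perm X.Chamber) y₀)

/-- The action of `Aut(X)` on horofunctions of `(Res(X), root-distance)`. -/
def actHoroRes (z₀ : X.Res) (g : X.Aut) (h : X.Res → ℝ) : X.Res → ℝ :=
  fun y => h (X.actRes g⁻¹ y) - h (X.actRes g⁻¹ z₀)

end Bldg

namespace CoxeterSystem

variable (cs : CoxeterSystem M W)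

/-- The standard parabolic subgroup generated by the simple reflections in `I`. -/
abbrev parab (I : Set B) : Subgroup W := Subgroup.closure (cs.simple '' I)

open Classical in
/-- The simple reflection `s` acts on `W × ZMod 2` by `(t, ε) ↦ (s t s, ε + [t = s])`. -/
def reflPerm (i : B) : Equiv.Perm (W × ZMod 2) :=
  Function.Involutive.toPerm
    (fun p => (cs.simple i * p.1 * cs.simple i, p.2 + if p.1 = cs.simple i then 1 else 0)) (by
      rintro ⟨t, ε⟩
      have h : cs.simple i * t * cs.simple i = cs.simple i ↔ t = cs.simple i := by
        constructor
        · intro h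
          have h2 := congrArg (fun z => cs.simple i * z * cs.simple i) h
          simpa [mul_assoc] using h2
        · rintro rfl; simp
      ext
      · simp [mul_assoc]
      · simp only [h]
        rw [add_assoc, CharTwo.add_self_eq_zero, add_zero])

open Classical in
theorem reflPerm_apply (i : B) (t : W) (ε : ZMod 2) :
    cs.reflPerm i (t, ε) =
      (cs.simple i * t * cs.simple i, ε + if t = cs.simple i then 1 else 0) := rfl

open Classical in
theorem reflPerm_pow (i j : B) (k : ℕ) (t : W) (ε : ZMod 2) :
    ((cs.reflPerm i * cs.reflPerm j) ^ k) (t, ε) =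
      ((cs.simple i * cs.simple j) ^ k * t * ((cs.simple i * cs.simple j) ^ k)⁻¹,
        ε + ∑ n ∈ Finset.range (2 * k),
          if t = cs.simple j * (cs.simple i * cs.simple j) ^ n then 1 else 0) := by
  induction k with
  | zero => simp
  | succ k ih =>
    set u := cs.simple i * cs.simple j with hu
    have hui : u⁻¹ = cs.simple j * cs.simple i := by simp [hu]
    have hc : ∀ n : ℕ, cs.simple j * u ^ n = (u ^ n)⁻¹ * cs.simple j := by
      intro n
      have : SemiconjBy (cs.simple j) u u⁻¹ := by
        simp [SemiconjBy, hu, mul_assoc]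
      simpa using (this.pow_right n).eq
    have h1 : u ^ k * t * (u ^ k)⁻¹ = cs.simple j ↔ t = cs.simple j * u ^ (2 * k) := by
      rw [two_mul, pow_add, ← mul_assoc, hc, mul_inv_eq_iff_eq_mul, mul_assoc,
        ← eq_inv_mul_iff_mul_eq]
    have h2 : cs.simple j * (u ^ k * t * (u ^ k)⁻¹) * cs.simple j = cs.simple i ↔
        t = cs.simple j * u ^ (2 * k + 1) := by
      have e1 : cs.simple j * u ^ (2 * k + 1) =
          (u ^ k)⁻¹ * (cs.simple j * cs.simple i * cs.simple j) * u ^ k := by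
        rw [two_mul, add_assoc, pow_add, ← mul_assoc, hc, pow_succ', hu]
        simp only [mul_assoc]
      rw [e1]
      constructor
      · intro h
        rw [← h]
        simp [mul_assoc]
      · rintro rfl
        simp [mul_assoc]
    rw [pow_succ', Equiv.Perm.mul_apply, ih, Equiv.Perm.mul_apply, reflPerm_apply,
      reflPerm_apply]
    ext
    · simp [pow_succ', hu, mul_assoc]
    · simp only [h1, h2]
      rw [show 2 * (k + 1) = 2 * k + 1 + 1 by ring, Finset.sum_range_succ,
        Finset.sum_range_succ]
      ring

theorem reflPerm_isLiftable : M.IsLiftable cs.reflPerm := by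
  classical
  intro i j
  ext1 ⟨t, ε⟩
  rw [reflPerm_pow, cs.simple_mul_simple_pow, two_mul, Finset.sum_range_add]
  have : ∀ n, (cs.simple i * cs.simple j) ^ (M i j + n) = (cs.simple i * cs.simple j) ^ n := by
    intro n; rw [pow_add, cs.simple_mul_simple_pow, one_mul]
  simp only [this, CharTwo.add_self_eq_zero]
  simp

/-- The action of `W` on `W × ZMod 2` extending `reflPerm`. -/
def reflAction : W →* Equiv.Perm (W × ZMod 2) :=
  cs.lift ⟨cs.reflPerm, cs.reflPerm_isLiftable⟩

/-- The reflection cocycle: the parity of the number of occurrences of `t` in the right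
inversion sequence of any word for `w`. -/
def reflCocycle (w t : W) : ZMod 2 := (cs.reflAction w (t, 0)).2

theorem reflAction_apply (w t : W) (ε : ZMod 2) :
    cs.reflAction w (t, ε) = (w * t * w⁻¹, ε + cs.reflCocycle w t) := by
  classical
  unfold reflCocycle
  induction w using cs.simple_induction_left generalizing t ε with
  | one => simp
  | mul_simple_left w i ih =>
    rw [map_mul, Equiv.Perm.mul_apply, ih, Equiv.Perm.mul_apply, ih t 0]
    have : cs.reflAction (cs.simple i) = cs.reflPerm i := cs.lift_apply_simple _ i
    rw [this, reflPerm_apply, reflPerm_apply]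
    ext
    · simp [mul_assoc]
    · simp [add_assoc]

theorem reflCocycle_mul (a b t : W) :
    cs.reflCocycle (a * b) t = cs.reflCocycle b t + cs.reflCocycle a (b * t * b⁻¹) := by
  have h := congrArg Prod.snd (cs.reflAction_apply (a * b) t 0)
  rw [map_mul, Equiv.Perm.mul_apply, reflAction_apply, reflAction_apply] at h
  simpa using h.symm

open Classical in
theorem reflCocycle_simple (i : B) (t : W) :
    cs.reflCocycle (cs.simple i) t = if t = cs.simple i then 1 else 0 := by
  have : cs.reflAction (cs.simple i) = cs.reflPerm i := cs.lift_apply_simple _ i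
  rw [reflCocycle, this, reflPerm_apply, zero_add]

theorem reflCocycle_one (t : W) : cs.reflCocycle 1 t = 0 := by
  simp [reflCocycle]

theorem reflCocycle_self {t : W} (ht : cs.IsReflection t) : cs.reflCocycle t t = 1 := by
  obtain ⟨w, i, rfl⟩ := ht
  have h := cs.reflCocycle_mul w w⁻¹ (w * cs.simple i * w⁻¹)
  rw [mul_inv_cancel, reflCocycle_one] at h
  rw [mul_assoc w, reflCocycle_mul, reflCocycle_mul, reflCocycle_simple, if_pos (by group)]
  have e1 : w⁻¹ * (w * (cs.simple i * w⁻¹)) * w⁻¹⁻¹ = cs.simple i := by group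
  have e2 : cs.simple i * w⁻¹ * (w * (cs.simple i * w⁻¹)) * (cs.simple i * w⁻¹)⁻¹ =
      cs.simple i := by simp [mul_assoc]
  have e3 : w⁻¹ * (w * cs.simple i * w⁻¹) * w⁻¹⁻¹ = cs.simple i := by group
  rw [e2]
  rw [e3, mul_assoc] at h
  linear_combination -h

theorem mem_rightInvSeq_of_reflCocycle_ne_zero (ω : List B) {t : W}
    (h : cs.reflCocycle (cs.wordProd ω) t ≠ 0) : t ∈ cs.rightInvSeq ω := by
  classical
  induction ω with
  | nil => simp [reflCocycle_one] at h
  | cons i ω ih =>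
    rw [wordProd_cons, reflCocycle_mul, reflCocycle_simple] at h
    rw [rightInvSeq, List.mem_cons]
    by_cases h0 : cs.reflCocycle (cs.wordProd ω) t = 0
    · left
      rw [h0, zero_add] at h
      have : cs.wordProd ω * t * (cs.wordProd ω)⁻¹ = cs.simple i := by
        by_contra hne
        simp [hne] at h
      rw [← this]; group
    · exact Or.inr (ih h0)

theorem reflCocycle_eq_one_iff {w t : W} (ht : cs.IsReflection t) :
    cs.reflCocycle w t = 1 ↔ cs.length (w * t) < cs.length w := by
  have key : ∀ w, cs.reflCocycle w t = 1 → cs.length (w * t) < cs.length w := by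
    intro w h
    obtain ⟨ω, hω, rfl⟩ := cs.exists_isReduced w
    exact (cs.isRightInversion_of_mem_rightInvSeq hω
      (cs.mem_rightInvSeq_of_reflCocycle_ne_zero ω (by rw [h]; exact one_ne_zero))).2
  refine ⟨key w, fun hlt => ?_⟩
  by_contra hne
  have h0 : cs.reflCocycle w t = 0 := by
    generalize cs.reflCocycle w t = z at *
    revert hne; revert z; decide
  have h1 := key (w * t) (by
    rw [reflCocycle_mul, cs.reflCocycle_self ht]
    simp [mul_assoc, h0])
  rw [mul_assoc, ht.mul_self, mul_one] at h1
  omega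

theorem rightInversion_mul_iff {a b t : W} (ht : cs.IsReflection t) :
    cs.length (a * b * t) < cs.length (a * b) ↔
      ((cs.length (b * t) < cs.length b) ↔
        ¬ cs.length (a * (b * t * b⁻¹)) < cs.length a) := by
  rw [← cs.reflCocycle_eq_one_iff ht, ← cs.reflCocycle_eq_one_iff ht,
    ← cs.reflCocycle_eq_one_iff (ht.conj b), reflCocycle_mul]
  generalize cs.reflCocycle b t = x
  generalize cs.reflCocycle a (b * t * b⁻¹) = y
  revert x y; decide

theorem leftInversion_mul_iff {a b t : W} (ht : cs.IsReflection t) :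
    cs.length (t * (a * b)) < cs.length (a * b) ↔
      ((cs.length (t * a) < cs.length a) ↔
        ¬ cs.length (a⁻¹ * t * a * b) < cs.length b) := by
  have h := cs.rightInversion_mul_iff (a := b⁻¹) (b := a⁻¹) ht
  rw [← cs.length_inv (t * (a * b)), ← cs.length_inv (a * b), ← cs.length_inv (t * a),
    ← cs.length_inv a, ← cs.length_inv (a⁻¹ * t * a * b), ← cs.length_inv b]
  simpa [mul_assoc, ht.inv] using h

theorem exists_eraseIdx_of_leftInversion {ω : List B} {t : W} (ht : cs.IsReflection t)
    (h : cs.length (t * cs.wordProd ω) < cs.length (cs.wordProd ω)) :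
    ∃ j < ω.length, t * cs.wordProd ω = cs.wordProd (ω.eraseIdx j) := by
  have h1 : cs.reflCocycle (cs.wordProd ω.reverse) t = 1 := by
    rw [cs.reflCocycle_eq_one_iff ht, wordProd_reverse]
    rwa [← cs.length_inv, ← cs.length_inv (cs.wordProd ω)⁻¹, mul_inv_rev, inv_inv, ht.inv]
  have h2 := cs.mem_rightInvSeq_of_reflCocycle_ne_zero ω.reverse (t := t)
    (by rw [h1]; exact one_ne_zero)
  rw [rightInvSeq_reverse, List.mem_reverse] at h2
  obtain ⟨j, hj, rfl⟩ := List.mem_iff_getElem.1 h2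
  rw [length_leftInvSeq] at hj
  refine ⟨j, hj, ?_⟩
  have := cs.getD_leftInvSeq_mul_wordProd ω j
  rwa [List.getD_eq_getElem _ _ (by rwa [length_leftInvSeq])] at this

end CoxeterSystem

namespace CoxeterSystem

variable (cs : CoxeterSystem M W)

/-- `u` is a prefix of `m`, i.e. lies below `m` in the weak order. -/
def IsPrefix (u m : W) : Prop := cs.length m = cs.length u + cs.length (u⁻¹ * m)

/-- `q` is the shortest element of `W_I q`. -/
def LeftReduced (I : Set B) (q : W) : Prop :=
  ∀ i ∈ I, cs.length q < cs.length (cs.simple i * q)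

/-- `q` is the shortest element of `q W_I`. -/
def RightReduced (I : Set B) (q : W) : Prop :=
  ∀ i ∈ I, cs.length q < cs.length (q * cs.simple i)

variable {cs}

theorem isPrefix_refl (a : W) : cs.IsPrefix a a := by simp [IsPrefix]

theorem one_isPrefix (a : W) : cs.IsPrefix 1 a := by simp [IsPrefix]

theorem length_le_add (a b : W) : cs.length b ≤ cs.length a + cs.length (a⁻¹ * b) := by
  simpa using cs.length_mul_le a (a⁻¹ * b)

theorem IsPrefix.trans {a b c : W} (h1 : cs.IsPrefix a b) (h2 : cs.IsPrefix b c) :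
    cs.IsPrefix a c := by
  unfold IsPrefix at *
  have h3 := length_le_add (cs := cs) a c
  have h4 := cs.length_mul_le (a⁻¹ * b) (b⁻¹ * c)
  simp only [mul_assoc, mul_inv_cancel_left] at h4
  omega

theorem IsPrefix.length_le {a b : W} (h : cs.IsPrefix a b) : cs.length a ≤ cs.length b := by
  unfold IsPrefix at h; omega

theorem IsPrefix.antisymm {a b : W} (h1 : cs.IsPrefix a b) (h2 : cs.IsPrefix b a) : a = b := by
  unfold IsPrefix at *
  have : cs.length (a⁻¹ * b) = 0 := by omega
  rw [cs.length_eq_zero_iff] at this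
  exact inv_mul_eq_one.1 this

theorem isPrefix_mul_iff {a x : W} :
    cs.IsPrefix a (a * x) ↔ cs.length (a * x) = cs.length a + cs.length x := by
  simp [IsPrefix]

theorem IsPrefix.mul {a x m : W} (ha : cs.IsPrefix a m) (hx : cs.IsPrefix x (a⁻¹ * m)) :
    cs.IsPrefix a (a * x) ∧ cs.IsPrefix (a * x) m := by
  rw [isPrefix_mul_iff]
  unfold IsPrefix at *
  have h1 := cs.length_mul_le a x
  have h2 := length_le_add (cs := cs) (a * x) m
  rw [show x⁻¹ * (a⁻¹ * m) = (a * x)⁻¹ * m by group] at hx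
  omega

theorem IsPrefix.of_mul {a x m : W} (h1 : cs.IsPrefix a (a * x)) (h2 : cs.IsPrefix (a * x) m) :
    cs.IsPrefix x (a⁻¹ * m) := by
  have h3 := h1.trans h2
  rw [isPrefix_mul_iff] at h1
  unfold IsPrefix at *
  rw [show x⁻¹ * (a⁻¹ * m) = (a * x)⁻¹ * m by group]
  omega

theorem IsPrefix.inv_mul {a b m : W} (h1 : cs.IsPrefix a b) (h2 : cs.IsPrefix b m) :
    cs.IsPrefix (a⁻¹ * b) (a⁻¹ * m) :=
  IsPrefix.of_mul (by simpa using h1) (by simpa using h2)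

theorem simple_isPrefix_iff {i : B} {m : W} :
    cs.IsPrefix (cs.simple i) m ↔ cs.length (cs.simple i * m) < cs.length m := by
  simp only [IsPrefix, length_simple, inv_simple]
  have := cs.length_simple_mul m i
  omega

theorem simple_isPrefix_mul_iff {i : B} {m : W} :
    cs.IsPrefix (cs.simple i) (cs.simple i * m) ↔
      cs.length m < cs.length (cs.simple i * m) := by
  simp only [IsPrefix, length_simple, inv_simple, simple_mul_simple_cancel_left]
  have := cs.length_simple_mul m i
  omega

theorem isPrefix_mul_simple_iff {i : B} {m : W} :
    cs.IsPrefix m (m * cs.simple i) ↔ cs.length m < cs.length (m * cs.simple i) := by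
  simp only [isPrefix_mul_iff, length_simple]
  have := cs.length_mul_simple m i
  omega

/-! ### Parabolic subgroups -/

theorem simple_mem_parab {I : Set B} {i : B} (h : i ∈ I) : cs.simple i ∈ cs.parab I :=
  Subgroup.subset_closure ⟨i, h, rfl⟩

theorem parab_mono {I J : Set B} (h : I ⊆ J) : cs.parab I ≤ cs.parab J :=
  Subgroup.closure_mono (Set.image_mono h)

theorem parab_induction {I : Set B} {p : W → Prop} (one : p 1)
    (mul : ∀ i ∈ I, ∀ w ∈ cs.parab I, p w → p (cs.simple i * w)) {w : W}
    (hw : w ∈ cs.parab I) : p w := by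
  induction hw using Subgroup.closure_induction_left with
  | one => exact one
  | mul_left x hx y hy ih =>
    obtain ⟨i, hi, rfl⟩ := hx
    exact mul i hi y hy ih
  | inv_mul_cancel x hx y hy ih =>
    obtain ⟨i, hi, rfl⟩ := hx
    rw [inv_simple]
    exact mul i hi y hy ih

theorem wordProd_mem_parab {I : Set B} {ω : List B} (h : ∀ i ∈ ω, i ∈ I) :
    cs.wordProd ω ∈ cs.parab I := by
  induction ω with
  | nil => simp
  | cons i ω ih =>
    rw [wordProd_cons]
    exact mul_mem (simple_mem_parab (h i (by simp))) (ih fun j hj => h j (by simp [hj]))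

theorem exists_isReduced_of_mem_parab {I : Set B} {w : W} (hw : w ∈ cs.parab I) :
    ∃ ω : List B, cs.IsReduced ω ∧ (∀ i ∈ ω, i ∈ I) ∧ w = cs.wordProd ω := by
  refine parab_induction (p := fun w => ∃ ω : List B, cs.IsReduced ω ∧ (∀ i ∈ ω, i ∈ I) ∧
    w = cs.wordProd ω) ⟨[], by simp [IsReduced], by simp, by simp⟩ ?_ hw
  · rintro i hi w - ⟨ω, hω, hI, rfl⟩
    rcases cs.length_simple_mul (cs.wordProd ω) i with h | h
    · refine ⟨i :: ω, ?_, ?_, by rw [wordProd_cons]⟩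
      · rw [IsReduced, wordProd_cons, h, hω.eq, List.length_cons]
      · simpa using ⟨hi, hI⟩
    · obtain ⟨j, hj, he⟩ := cs.exists_eraseIdx_of_leftInversion (ω := ω)
        (cs.isReflection_simple i) (by omega)
      refine ⟨ω.eraseIdx j, ?_, fun k hk => hI k (List.eraseIdx_subset hk), he⟩
      have h1 := hω.eq
      have h2 := List.length_eraseIdx_add_one hj
      rw [IsReduced, ← he]
      omega

theorem exists_leftDescent_of_mem_parab {I : Set B} {w : W} (hw : w ∈ cs.parab I)
    (h1 : w ≠ 1) : ∃ i ∈ I, cs.length (cs.simple i * w) < cs.length w := by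
  obtain ⟨ω, hω, hI, rfl⟩ := exists_isReduced_of_mem_parab hw
  match ω, hω with
  | [], _ => simp at h1
  | i :: ω, hω =>
    refine ⟨i, hI i (by simp), ?_⟩
    rw [hω.eq, wordProd_cons, simple_mul_simple_cancel_left, List.length_cons]
    exact Nat.lt_succ_of_le (cs.length_wordProd_le ω)

theorem exists_eq_simple_of_mem_parab {I : Set B} {w : W} (hw : w ∈ cs.parab I)
    (h : cs.length w = 1) : ∃ k ∈ I, w = cs.simple k := by
  obtain ⟨k, hk, hlt⟩ := exists_leftDescent_of_mem_parab hw (by rintro rfl; simp at h)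
  refine ⟨k, hk, ?_⟩
  have : cs.simple k * w = 1 := cs.length_eq_zero_iff.1 (by omega)
  rw [← cs.inv_simple, inv_mul_eq_one] at this
  exact this.symm

theorem exists_leftReduced_decomp (I : Set B) (w : W) :
    ∃ p ∈ cs.parab I, ∃ q, w = p * q ∧ ∀ u ∈ cs.parab I, cs.length q ≤ cs.length (u * q) := by
  obtain ⟨q, ⟨p, hp, rfl⟩, hmin⟩ := exists_minimalFor_of_wellFoundedLT
    (fun q => ∃ p ∈ cs.parab I, w = p * q) cs.length ⟨w, 1, one_mem _, by simp⟩
  refine ⟨p, hp, q, rfl, fun u hu => ?_⟩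
  by_contra! h
  have := hmin (j := u * q) ⟨p * u⁻¹, mul_mem hp (inv_mem hu), by group⟩ h.le
  omega

theorem length_mul_of_minimal {I : Set B} {q : W}
    (hq : ∀ u ∈ cs.parab I, cs.length q ≤ cs.length (u * q)) {p : W} (hp : p ∈ cs.parab I) :
    cs.length (p * q) = cs.length p + cs.length q := by
  generalize hn : cs.length p = n
  induction n generalizing p with
  | zero =>
    rw [cs.length_eq_zero_iff] at hn
    simp [hn]
  | succ n ih =>
    obtain ⟨i, hi, hlt⟩ := exists_leftDescent_of_mem_parab hp (by rintro rfl; simp at hn)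
    have hdesc := cs.length_simple_mul p i
    set p' := cs.simple i * p with hp'
    have hp'm : p' ∈ cs.parab I := mul_mem (simple_mem_parab hi) hp
    have hpp : p = cs.simple i * p' := by simp [hp']
    have ih' := ih hp'm (by omega)
    rcases cs.length_simple_mul (p' * q) i with h | h
    · rw [hpp, mul_assoc]; omega
    · exfalso
      have hx := (cs.leftInversion_mul_iff (a := p') (b := q) (cs.isReflection_simple i)).1
        (by omega)
      have hm : p'⁻¹ * cs.simple i * p' ∈ cs.parab I :=
        mul_mem (mul_mem (inv_mem hp'm) (simple_mem_parab hi)) hp'm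
      have h1 := hq _ hm
      have h2 := hx.2 (by omega)
      rw [← hpp] at h2
      omega

theorem LeftReduced.minimal {I : Set B} {q : W} (hq : cs.LeftReduced I q) :
    ∀ u ∈ cs.parab I, cs.length q ≤ cs.length (u * q) := by
  obtain ⟨p, hp, q0, rfl, hq0⟩ := exists_leftReduced_decomp (cs := cs) I q
  by_cases h1 : p = 1
  · simpa [h1] using hq0
  · obtain ⟨i, hi, hlt⟩ := exists_leftDescent_of_mem_parab hp h1
    have := hq i hi
    rw [← mul_assoc, length_mul_of_minimal hq0 hp,
      length_mul_of_minimal hq0 (mul_mem (simple_mem_parab hi) hp)] at this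
    omega

theorem LeftReduced.length_mul {I : Set B} {q : W} (hq : cs.LeftReduced I q) {p : W}
    (hp : p ∈ cs.parab I) : cs.length (p * q) = cs.length p + cs.length q :=
  length_mul_of_minimal hq.minimal hp

theorem leftReduced_inv_iff {I : Set B} {q : W} :
    cs.LeftReduced I q⁻¹ ↔ cs.RightReduced I q := by
  unfold LeftReduced RightReduced
  refine forall₂_congr fun i _ => ?_
  rw [← cs.length_inv (q * cs.simple i), mul_inv_rev, inv_simple, cs.length_inv]

theorem RightReduced.length_mul {I : Set B} {q : W} (hq : cs.RightReduced I q) {p : W}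
    (hp : p ∈ cs.parab I) : cs.length (q * p) = cs.length q + cs.length p := by
  have := (leftReduced_inv_iff.2 hq).length_mul (inv_mem hp)
  rwa [← mul_inv_rev, cs.length_inv, cs.length_inv, cs.length_inv, add_comm] at this

theorem exists_mul_leftReduced (I : Set B) (w : W) :
    ∃ p ∈ cs.parab I, ∃ q, w = p * q ∧ cs.LeftReduced I q := by
  obtain ⟨p, hp, q, h, hq⟩ := exists_leftReduced_decomp (cs := cs) I w
  refine ⟨p, hp, q, h, fun i hi => ?_⟩
  have h1 := hq _ (simple_mem_parab hi)
  have h2 := cs.length_simple_mul_ne q i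
  omega

theorem exists_rightReduced_mul (I : Set B) (w : W) :
    ∃ q, ∃ p ∈ cs.parab I, w = q * p ∧ cs.RightReduced I q := by
  obtain ⟨p, hp, q, h, hq⟩ := exists_mul_leftReduced (cs := cs) I w⁻¹
  exact ⟨q⁻¹, p⁻¹, inv_mem hp, by rw [← mul_inv_rev, ← h, inv_inv],
    leftReduced_inv_iff.1 (by rwa [inv_inv])⟩

theorem exists_right_factor {b : W} {n : ℕ}
    (h : cs.length b = n + 1) :
    ∃ b' i, b = b' * cs.simple i ∧ cs.length b' = n ∧
      b' = b * cs.simple i := by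
  obtain ⟨i, hi⟩ := cs.exists_rightDescent_of_ne_one (w := b) (by rintro rfl; simp at h)
  rw [isRightDescent_iff] at hi
  exact ⟨b * cs.simple i, i, by simp, by omega, rfl⟩

/-! ### Elements with many descents -/

theorem isPrefix_of_forall_leftDescent {D : Set B} {m : W}
    (hD : ∀ i ∈ D, cs.length (cs.simple i * m) < cs.length m) {w : W}
    (hw : w ∈ cs.parab D) : cs.IsPrefix w m := by
  generalize hn : cs.length w = n
  induction n generalizing w with
  | zero =>
    rw [cs.length_eq_zero_iff] at hn
    simpa [hn] using one_isPrefix m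
  | succ n ih =>
    obtain ⟨i, hi, hlt⟩ := exists_leftDescent_of_mem_parab hw (by rintro rfl; simp at hn)
    have hdesc := cs.length_simple_mul w i
    set v := cs.simple i * w with hv
    have hvm : v ∈ cs.parab D := mul_mem (simple_mem_parab hi) hw
    have hwv : w = cs.simple i * v := by simp [hv]
    have ih' := ih hvm (by omega)
    have hx := (cs.leftInversion_mul_iff (a := v) (b := v⁻¹ * m)
      (cs.isReflection_simple i)).1 (by simpa using hD i hi)
    have h2 : cs.length (w⁻¹ * m) < cs.length (v⁻¹ * m) := by
      by_contra h3
      rw [show v⁻¹ * cs.simple i * v * (v⁻¹ * m) = w⁻¹ * m by simp [hwv, mul_assoc],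
        ← hwv] at hx
      have := hx.2 h3
      omega
    have h3 := length_le_add (cs := cs) w m
    unfold IsPrefix at *
    omega

theorem eq_of_forall_leftDescent {D : Set B} {m m' : W} (hm : m ∈ cs.parab D)
    (hm' : m' ∈ cs.parab D) (h : ∀ i ∈ D, cs.length (cs.simple i * m) < cs.length m)
    (h' : ∀ i ∈ D, cs.length (cs.simple i * m') < cs.length m') : m = m' :=
  (isPrefix_of_forall_leftDescent h' hm).antisymm (isPrefix_of_forall_leftDescent h hm')

theorem finite_parab_of_forall_leftDescent {D : Set B} (hfin : (cs.simple '' D).Finite) {m : W}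
    (h : ∀ i ∈ D, cs.length (cs.simple i * m) < cs.length m) :
    (cs.parab D : Set W).Finite := by
  have ball : ∀ n, {w | w ∈ cs.parab D ∧ cs.length w ≤ n}.Finite := by
    intro n
    induction n with
    | zero =>
      refine (Set.finite_singleton (1 : W)).subset ?_
      rintro w ⟨-, hw⟩
      exact cs.length_eq_zero_iff.1 (by omega)
    | succ n ih =>
      refine (ih.union (hfin.mul ih)).subset ?_
      rintro w ⟨hw, hl⟩
      by_cases h1 : w = 1
      · left; subst h1; simp
      · right
        obtain ⟨i, hi, hlt⟩ := exists_leftDescent_of_mem_parab hw h1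
        exact ⟨cs.simple i, ⟨i, hi, rfl⟩, cs.simple i * w,
          ⟨mul_mem (simple_mem_parab hi) hw, by omega⟩, by simp⟩
  exact (ball (cs.length m)).subset fun w hw =>
    ⟨hw, (isPrefix_of_forall_leftDescent h hw).length_le⟩

theorem exists_forall_leftDescent_of_bounded (I : Set B) (N : ℕ)
    (h : ∀ w ∈ cs.parab I, cs.length w ≤ N) :
    ∃ m ∈ cs.parab I, ∀ i ∈ I, cs.length (cs.simple i * m) < cs.length m := by
  obtain ⟨m, hm, hmax⟩ := exists_minimalFor_of_wellFoundedLT (fun m => m ∈ cs.parab I)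
    (fun m => N - cs.length m) ⟨1, one_mem _⟩
  refine ⟨m, hm, fun i hi => ?_⟩
  have hi' := mul_mem (simple_mem_parab hi) hm
  have h1 := hmax (j := cs.simple i * m) hi'
  have h2 := cs.length_simple_mul_ne m i
  have h3 := h _ hi'
  have h4 := h _ hm
  dsimp only at h1
  omega

theorem exists_longest {I : Set B} (h : (cs.parab I : Set W).Finite) :
    ∃ m ∈ cs.parab I, ∀ i ∈ I, cs.length (cs.simple i * m) < cs.length m := by
  obtain ⟨N, hN⟩ := (h.image cs.length).bddAbove
  exact exists_forall_leftDescent_of_bounded I N fun w hw => hN ⟨w, hw, rfl⟩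

/-! ### Greatest common prefixes -/

variable (cs) in
/-- `v` is the greatest common prefix of the elements of `R`. -/
def IsGcp (R : Set W) (v : W) : Prop :=
  (∀ r ∈ R, cs.IsPrefix v r) ∧ ∀ a, (∀ r ∈ R, cs.IsPrefix a r) → cs.IsPrefix a v

theorem exists_isGcp {R : Set W} (hR : R.Nonempty) : ∃ v, cs.IsGcp R v := by
  obtain ⟨r0, hr0⟩ := hR
  generalize hn : cs.length r0 = n
  induction n using Nat.strong_induction_on generalizing R r0 with
  | _ n ih =>
  set D : Set B := {i | ∀ r ∈ R, cs.IsPrefix (cs.simple i) r} with hDdef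
  have hD : ∀ i ∈ D, ∀ r ∈ R, cs.length (cs.simple i * r) < cs.length r :=
    fun i hi r hr => simple_isPrefix_iff.1 (hi r hr)
  have hcommon : ∀ a, (∀ r ∈ R, cs.IsPrefix a r) → a ≠ 1 →
      ∃ i ∈ D, cs.IsPrefix (cs.simple i) a := by
    intro a ha h1
    obtain ⟨i, hi⟩ := cs.exists_leftDescent_of_ne_one h1
    have hp : cs.IsPrefix (cs.simple i) a := simple_isPrefix_iff.2 hi
    exact ⟨i, fun r hr => hp.trans (ha r hr), hp⟩
  by_cases hDe : D = ∅
  · refine ⟨1, fun r _ => one_isPrefix r, fun a ha => ?_⟩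
    by_cases h1 : a = 1
    · rw [h1]; exact isPrefix_refl 1
    · obtain ⟨i, hi, -⟩ := hcommon a ha h1
      rw [hDe] at hi
      exact hi.elim
  · have hpre : ∀ r ∈ R, ∀ w ∈ cs.parab D, cs.IsPrefix w r := fun r hr w hw =>
      isPrefix_of_forall_leftDescent (fun i hi => hD i hi r hr) hw
    obtain ⟨m, hm, hmD⟩ := exists_forall_leftDescent_of_bounded D _
      fun w hw => (hpre r0 hr0 w hw).length_le
    have hmR := fun r hr => hpre r hr m hm
    have step : ∀ a, a ≠ 1 → (∀ r ∈ R, cs.IsPrefix a r) →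
        ∃ v, cs.IsGcp ((fun r => a⁻¹ * r) '' R) v := by
      intro a ha haR
      refine ih _ ?_ (r0 := a⁻¹ * r0) ⟨r0, hr0, rfl⟩ rfl
      have h1 := haR r0 hr0
      have h2 : cs.length a ≠ 0 := fun h => ha (cs.length_eq_zero_iff.1 h)
      unfold IsPrefix at h1
      omega
    obtain ⟨i0, hi0⟩ := Set.nonempty_iff_ne_empty.2 hDe
    obtain ⟨v, hv1, hv2⟩ := step m (by
      rintro rfl
      have := hmD i0 hi0
      simp at this) hmR
    refine ⟨m * v, fun r hr => ((hmR r hr).mul (hv1 _ ⟨r, hr, rfl⟩)).2, fun a ha => ?_⟩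
    by_cases h1 : a = 1
    · rw [h1]; exact one_isPrefix _
    · obtain ⟨i, hi, hia⟩ := hcommon a ha h1
      obtain ⟨g, hg1, hg2⟩ := step (cs.simple i) (by
        intro h
        have := cs.length_simple i
        rw [h, cs.length_one] at this
        omega) hi
      have hsg : ∀ r ∈ R, cs.IsPrefix (cs.simple i) (cs.simple i * g) ∧
          cs.IsPrefix (cs.simple i * g) r := fun r hr => (hi r hr).mul (hg1 _ ⟨r, hr, rfl⟩)
      have hle : ∀ b, (∀ r ∈ R, cs.IsPrefix b r) → cs.IsPrefix (cs.simple i) b →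
          cs.IsPrefix b (cs.simple i * g) := by
        intro b hb hib
        have h2 := hg2 ((cs.simple i)⁻¹ * b) (by
          rintro _ ⟨r, hr, rfl⟩
          exact hib.inv_mul (hb r hr))
        have h3 := (hsg r0 hr0).1.mul (x := (cs.simple i)⁻¹ * b) (by simpa using h2)
        simpa using h3.2
      have hmg := hle m hmR (simple_isPrefix_iff.2 (hmD i hi))
      have h4 := hv2 (m⁻¹ * (cs.simple i * g)) (by
        rintro _ ⟨r, hr, rfl⟩
        exact hmg.inv_mul (hsg r hr).2)
      have h5 : cs.IsPrefix m (m * v) :=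
        ((hmR r0 hr0).mul (hv1 _ ⟨r0, hr0, rfl⟩)).1
      have h6 := (h5.mul (x := m⁻¹ * (cs.simple i * g)) (by simpa using h4)).2
      rw [mul_inv_cancel_left] at h6
      exact (hle a ha hia).trans h6

theorem IsGcp.inv_mul {R : Set W} (hR : R.Nonempty) {v a : W} (hv : cs.IsGcp R v)
    (ha : ∀ r ∈ R, cs.IsPrefix a r) : cs.IsGcp ((fun r => a⁻¹ * r) '' R) (a⁻¹ * v) := by
  have hav := hv.2 a ha
  refine ⟨?_, fun b hb => ?_⟩
  · rintro _ ⟨r, hr, rfl⟩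
    exact hav.inv_mul (hv.1 r hr)
  · have h1 : ∀ r ∈ R, cs.IsPrefix a (a * b) ∧ cs.IsPrefix (a * b) r :=
      fun r hr => (ha r hr).mul (hb _ ⟨r, hr, rfl⟩)
    obtain ⟨r, hr⟩ := hR
    exact IsPrefix.of_mul (h1 r hr).1 (hv.2 _ fun r hr => (h1 r hr).2)

theorem IsGcp.exists_ribbon {ι : Type*} [Nonempty ι] {ρ : ι → W} {y : W}
    (hy : cs.IsGcp (Set.range ρ) y) {i : B}
    (h : ∀ n, cs.length (ρ n) < cs.length (cs.simple i * ρ n) ∧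
      ∃ j, cs.simple i * ρ n = ρ n * cs.simple j) :
    ∃ k, cs.simple i * y = y * cs.simple k := by
  obtain ⟨g, hg⟩ := exists_isGcp (cs := cs) (Set.range_nonempty fun n => cs.simple i * ρ n)
  have h1 : ∀ r ∈ Set.range fun n => cs.simple i * ρ n, cs.IsPrefix (cs.simple i) r := by
    rintro _ ⟨n, rfl⟩
    exact simple_isPrefix_mul_iff.2 (h n).1
  have h2 : cs.IsPrefix y g := hg.2 y (by
    rintro _ ⟨n, rfl⟩
    refine (hy.1 _ ⟨n, rfl⟩).trans ?_
    obtain ⟨hlt, j, hj⟩ := h n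
    simp only [hj] at hlt ⊢
    exact isPrefix_mul_simple_iff.2 hlt)
  have hig := hg.2 _ h1
  have h3 : cs.IsPrefix ((cs.simple i)⁻¹ * g) y := hy.2 _ (by
    rintro _ ⟨n, rfl⟩
    have := hig.inv_mul (hg.1 _ ⟨n, rfl⟩)
    simpa using this)
  have h4 : cs.length y < cs.length (cs.simple i * y) := by
    by_contra h5
    have h6 := cs.length_simple_mul_ne y i
    have h7 : cs.IsPrefix (cs.simple i) y := simple_isPrefix_iff.2 (by omega)
    let n : ι := Classical.arbitrary ι
    have h8 := simple_isPrefix_iff.1 (h7.trans (hy.1 _ ⟨n, rfl⟩))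
    have := (h n).1
    omega
  have h5 : cs.IsPrefix g (cs.simple i * y) := by
    have := ((simple_isPrefix_mul_iff.2 h4).mul (x := (cs.simple i)⁻¹ * g) (by simpa using h3)).2
    simpa using this
  have h6 : cs.length (y⁻¹ * (cs.simple i * y)) = 1 := by
    have h7 := h2.trans h5
    have h8 := cs.length_simple_mul y i
    unfold IsPrefix at h7
    omega
  obtain ⟨k, hk⟩ := cs.length_eq_one_iff.1 h6
  exact ⟨k, by rw [← hk]; simp⟩

end CoxeterSystem

namespace CoxeterSystem

variable {cs : CoxeterSystem M W}

theorem mem_parab_of_leftInversion {I : Set B} {w t : W} (hw : w ∈ cs.parab I)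
    (ht : cs.IsReflection t) (h : cs.length (t * w) < cs.length w) : t ∈ cs.parab I := by
  obtain ⟨ω, -, hI, rfl⟩ := exists_isReduced_of_mem_parab hw
  obtain ⟨j, -, he⟩ := cs.exists_eraseIdx_of_leftInversion ht h
  have h1 : t * cs.wordProd ω ∈ cs.parab I := by
    rw [he]
    exact wordProd_mem_parab fun k hk => hI k (List.eraseIdx_subset hk)
  simpa using mul_mem h1 (inv_mem hw)

theorem conj_mem_parab {I J : Set B} {y : W}
    (h : ∀ i ∈ I, ∃ j ∈ J, cs.simple i * y = y * cs.simple j) {w : W} (hw : w ∈ cs.parab I) :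
    y⁻¹ * w * y ∈ cs.parab J := by
  refine parab_induction (p := fun w => y⁻¹ * w * y ∈ cs.parab J) (by simp) ?_ hw
  intro i hi w _ ih
  obtain ⟨j, hj, he⟩ := h i hi
  have : y⁻¹ * (cs.simple i * w) * y = cs.simple j * (y⁻¹ * w * y) := by
    have h2 : y⁻¹ * cs.simple i = cs.simple j * y⁻¹ := by
      rw [inv_mul_eq_iff_eq_mul, ← mul_assoc, ← he, mul_inv_cancel_right]
    rw [← mul_assoc, h2]
    simp only [mul_assoc]
  rw [this]
  exact mul_mem (simple_mem_parab hj) ih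

theorem parab_le_of_forall {I J : Set B}
    (h : ∀ i ∈ I, ∃ j ∈ J, cs.simple i = cs.simple j) : cs.parab I ≤ cs.parab J := by
  rw [Subgroup.closure_le]
  rintro _ ⟨i, hi, rfl⟩
  obtain ⟨j, hj, he⟩ := h i hi
  rw [he]
  exact simple_mem_parab hj

theorem finite_parab_of_conj {I J : Set B} {y : W} (hJ : (cs.parab J : Set W).Finite)
    (h : ∀ i ∈ I, ∃ j ∈ J, cs.simple i * y = y * cs.simple j) :
    (cs.parab I : Set W).Finite := by
  refine Set.Finite.of_finite_image (f := fun w => y⁻¹ * w * y) (hJ.subset ?_) ?_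
  · rintro _ ⟨w, hw, rfl⟩
    exact conj_mem_parab h hw
  · intro a _ b _ hab
    simpa using hab

/-- Those elements of `L` which `q` conjugates to simple reflections in `J`. -/
def tightSet (cs : CoxeterSystem M W) (J L : Set B) (q : W) : Set B :=
  {i | i ∈ L ∧ ∃ j ∈ J, cs.simple i * q = q * cs.simple j}

/-- The simple reflections obtained by conjugating those in `I` by `y`. -/
def conjSet (cs : CoxeterSystem M W) (I : Set B) (y : W) : Set B :=
  {k | ∃ i ∈ I, cs.simple i * y = y * cs.simple k}

theorem finite_parab_conjSet {I : Set B} (y : W) (hI : (cs.parab I : Set W).Finite) :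
    (cs.parab (cs.conjSet I y) : Set W).Finite := by
  refine finite_parab_of_conj (y := y⁻¹) hI ?_
  rintro k ⟨i, hi, he⟩
  exact ⟨i, hi, by rw [mul_inv_eq_iff_eq_mul, mul_assoc, he, inv_mul_cancel_left]⟩

theorem LeftReduced.mono {I : Set B} {a b : W} (hb : cs.LeftReduced I b)
    (h : cs.IsPrefix a b) : cs.LeftReduced I a := by
  intro i hi
  by_contra h1
  have h2 := cs.length_simple_mul_ne a i
  have h3 := simple_isPrefix_iff.1 ((simple_isPrefix_iff (i := i) |>.2 (by omega)).trans h)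
  have := hb i hi
  omega

theorem RightReduced.of_mul {J : Set B} {a b : W} (h : cs.RightReduced J (a * b))
    (hl : cs.length (a * b) = cs.length a + cs.length b) : cs.RightReduced J b := by
  intro j hj
  have h1 := h j hj
  have h2 := cs.length_mul_le a (b * cs.simple j)
  rw [mul_assoc] at h1
  omega

theorem LeftReduced.of_conj {I J : Set B} {q : W} (hq : cs.RightReduced J q)
    (h : ∀ i ∈ I, ∃ j ∈ J, cs.simple i * q = q * cs.simple j) : cs.LeftReduced I q := by
  intro i hi
  obtain ⟨j, hj, he⟩ := h i hi
  rw [he]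
  exact hq j hj

theorem RightReduced.of_conj {I J : Set B} {q : W} (hq : cs.LeftReduced I q)
    (h : ∀ j ∈ J, ∃ i ∈ I, cs.simple i * q = q * cs.simple j) : cs.RightReduced J q := by
  intro j hj
  obtain ⟨i, hi, he⟩ := h j hj
  rw [← he]
  exact hq i hi

/-- If `q` is `I`-reduced on the left, then an element of the parabolic subgroup
conjugated by `q` to a simple reflection is a simple reflection. -/
theorem LeftReduced.exists_simple {I : Set B} {q t : W} {k : B} (hq : cs.LeftReduced I q)
    (ht : t ∈ cs.parab I) (h : t * q = q * cs.simple k) : ∃ i ∈ I, t = cs.simple i := by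
  refine exists_eq_simple_of_mem_parab ht ?_
  have h1 := hq.length_mul ht
  have h2 : t ≠ 1 := by
    rintro rfl
    have := cs.length_mul_simple_ne q k
    rw [← h, one_mul] at this
    exact this rfl
  have h3 : cs.length t ≠ 0 := fun h0 => h2 (cs.length_eq_zero_iff.1 h0)
  have h4 := cs.length_mul_simple q k
  rw [h] at h1
  omega

theorem RightReduced.exists_simple {J : Set B} {q t : W} {k : B} (hq : cs.RightReduced J q)
    (ht : t ∈ cs.parab J) (h : cs.simple k * q = q * t) : ∃ j ∈ J, t = cs.simple j := by
  obtain ⟨j, hj, he⟩ := (leftReduced_inv_iff.2 hq).exists_simple (k := k) (inv_mem ht) (by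
    rw [← mul_inv_rev, ← h, mul_inv_rev, inv_simple])
  exact ⟨j, hj, by rw [← cs.inv_simple, ← he, inv_inv]⟩

theorem LeftReduced.mul_simple {L : Set B} {q : W} (hq : cs.LeftReduced L q) (j : B) :
    cs.LeftReduced L (q * cs.simple j) ∨ ∃ l ∈ L, cs.simple l * q = q * cs.simple j := by
  by_contra! hc
  obtain ⟨h1, h2⟩ := hc
  simp only [LeftReduced, not_forall] at h1
  obtain ⟨l, hl, h1⟩ := h1
  have h3 := cs.length_simple_mul_ne (q * cs.simple j) l
  have h4 := (cs.leftInversion_mul_iff (a := q) (b := cs.simple j)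
    (cs.isReflection_simple l)).1 (by omega)
  have h5 := hq l hl
  have h6 : cs.length (q⁻¹ * cs.simple l * q * cs.simple j) = 0 := by
    have h7 := cs.length_simple j
    by_contra h8
    have h9 := h4.2 (by omega)
    omega
  rw [cs.length_eq_zero_iff] at h6
  refine h2 l hl ?_
  have := congrArg (fun w => q * w * cs.simple j) h6
  simpa [mul_assoc] using this

theorem LeftReduced.exists_double_coset_decomp {J L : Set B} {q : W}
    (hL : cs.LeftReduced L q) (hJ : cs.RightReduced J q) {b : W} (hb : b ∈ cs.parab J) :
    ∃ a ∈ cs.parab (cs.tightSet J L q), ∃ c ∈ cs.parab J, q * b = a * (q * c) ∧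
      cs.LeftReduced L (q * c) := by
  have step : ∀ b ∈ cs.parab J, ∀ j ∈ J,
      (∃ a ∈ cs.parab (cs.tightSet J L q), ∃ c ∈ cs.parab J, q * b = a * (q * c) ∧
        cs.LeftReduced L (q * c)) →
      ∃ a ∈ cs.parab (cs.tightSet J L q), ∃ c ∈ cs.parab J, q * (b * cs.simple j) =
        a * (q * c) ∧ cs.LeftReduced L (q * c) := by
    rintro b - j hj ⟨a, ha, c, hc, he, hr⟩
    rcases hr.mul_simple j with h | ⟨l, hl, h⟩
    · exact ⟨a, ha, c * cs.simple j, mul_mem hc (simple_mem_parab hj),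
        by rw [← mul_assoc, he]; simp only [mul_assoc], by rwa [← mul_assoc]⟩
    · refine ⟨a * cs.simple l, mul_mem ha (simple_mem_parab ⟨hl, ?_⟩), c, hc, ?_, hr⟩
      · have h1 : cs.simple l * q = q * (c * cs.simple j * c⁻¹) := by
          have := congrArg (fun w => w * c⁻¹) h
          simpa [mul_assoc] using this
        obtain ⟨k, hk, hke⟩ := hJ.exists_simple
          (mul_mem (mul_mem hc (simple_mem_parab hj)) (inv_mem hc)) h1
        exact ⟨k, hk, by rw [h1, hke]⟩
      · rw [mul_assoc a, h, ← mul_assoc, he]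
        simp only [mul_assoc]
  induction hb using Subgroup.closure_induction_right with
  | one => exact ⟨1, one_mem _, 1, one_mem _, by simp, by simpa using hL⟩
  | mul_right b hb x hx ih =>
    obtain ⟨j, hj, rfl⟩ := hx
    exact step b hb j hj ih
  | mul_inv_cancel b hb x hx ih =>
    obtain ⟨j, hj, rfl⟩ := hx
    rw [inv_simple]
    exact step b hb j hj ih

/-- If `m` is the longest element of `W_I`, if `ρ` conjugates `I` into `J` and has `i₀` as a left
descent, and if `p` is the `W_L`-part of `ρ` for `L = I ∪ {i₀}`, then `m p` is the longest
element of `W_L`. -/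
theorem leftDescent_longest_mul {I J : Set B} {ρ m p q : W} {i₀ : B}
    (hJ : cs.RightReduced J ρ) (h : ∀ i ∈ I, ∃ j ∈ J, cs.simple i * ρ = ρ * cs.simple j)
    (hi : cs.IsPrefix (cs.simple i₀) ρ) (hm : m ∈ cs.parab I)
    (hmI : ∀ i ∈ I, cs.length (cs.simple i * m) < cs.length m)
    (hp : p ∈ cs.parab (insert i₀ I)) (hq : cs.LeftReduced (insert i₀ I) q)
    (he : ρ = p * q) :
    ∀ l ∈ insert i₀ I, cs.length (cs.simple l * (m * p)) < cs.length (m * p) := by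
  have hL := LeftReduced.of_conj hJ h
  have key : ∀ l ∈ insert i₀ I,
      cs.length (cs.simple l * (m * ρ)) < cs.length (m * ρ) := by
    rintro l (rfl | hl)
    · rw [← simple_isPrefix_iff]
      refine hi.trans ?_
      have h1 := conj_mem_parab h hm
      have h2 : m * ρ = ρ * (ρ⁻¹ * m * ρ) := by group
      rw [h2, isPrefix_mul_iff]
      exact hJ.length_mul h1
    · rw [← mul_assoc, hL.length_mul (mul_mem (simple_mem_parab hl) hm), hL.length_mul hm]
      exact Nat.add_lt_add_right (hmI l hl) _
  intro l hl
  have h1 := key l hl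
  have h2 := parab_mono (cs := cs) (Set.subset_insert i₀ I) hm
  have h3 : cs.simple l * (m * (p * q)) = (cs.simple l * (m * p)) * q := by
    simp only [mul_assoc]
  rw [he, h3, ← mul_assoc m p q,
    hq.length_mul (mul_mem (simple_mem_parab hl) (mul_mem h2 hp)),
    hq.length_mul (mul_mem h2 hp)] at h1
  omega

theorem finite_parab_insert {I J : Set B} {ρ : W} {i₀ : B} (hI : (cs.parab I : Set W).Finite)
    (hJ : cs.RightReduced J ρ) (h : ∀ i ∈ I, ∃ j ∈ J, cs.simple i * ρ = ρ * cs.simple j)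
    (hi : cs.IsPrefix (cs.simple i₀) ρ) : (cs.parab (insert i₀ I) : Set W).Finite := by
  obtain ⟨m, hm, hmI⟩ := exists_longest hI
  obtain ⟨p, hp, q, he, hq⟩ := exists_mul_leftReduced (cs := cs) (insert i₀ I) ρ
  refine finite_parab_of_forall_leftDescent ?_
    (leftDescent_longest_mul hJ h hi hm hmI hp hq he)
  rw [Set.image_insert_eq]
  exact (hI.subset Subgroup.subset_closure).insert _

/-- The `W_L`-part of `ρ` in `leftDescent_longest_mul` does not depend on `ρ`. -/
theorem parab_part_unique {I J J' : Set B} {ρ ρ' p p' q q' : W} {i₀ : B}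
    (hI : (cs.parab I : Set W).Finite)
    (hJ : cs.RightReduced J ρ) (h : ∀ i ∈ I, ∃ j ∈ J, cs.simple i * ρ = ρ * cs.simple j)
    (hi : cs.IsPrefix (cs.simple i₀) ρ) (hp : p ∈ cs.parab (insert i₀ I))
    (hq : cs.LeftReduced (insert i₀ I) q) (he : ρ = p * q)
    (hJ' : cs.RightReduced J' ρ') (h' : ∀ i ∈ I, ∃ j ∈ J', cs.simple i * ρ' = ρ' * cs.simple j)
    (hi' : cs.IsPrefix (cs.simple i₀) ρ') (hp' : p' ∈ cs.parab (insert i₀ I))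
    (hq' : cs.LeftReduced (insert i₀ I) q') (he' : ρ' = p' * q') : p = p' := by
  obtain ⟨m, hm, hmI⟩ := exists_longest hI
  have h2 := parab_mono (cs := cs) (Set.subset_insert i₀ I) hm
  exact mul_left_cancel (eq_of_forall_leftDescent (mul_mem h2 hp) (mul_mem h2 hp')
    (leftDescent_longest_mul hJ h hi hm hmI hp hq he)
    (leftDescent_longest_mul hJ' h' hi' hm hmI hp' hq' he'))

theorem parab_tightSet_eq {I J : Set B} {ρ p q : W} {i₀ : B}
    (hI : (cs.parab I : Set W).Finite)
    (hJ : cs.RightReduced J ρ) (h : ∀ i ∈ I, ∃ j ∈ J, cs.simple i * ρ = ρ * cs.simple j)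
    (hi : cs.IsPrefix (cs.simple i₀) ρ) (hp : p ∈ cs.parab (insert i₀ I))
    (hq : cs.LeftReduced (insert i₀ I) q) (he : ρ = p * q) :
    cs.parab (cs.tightSet J (insert i₀ I) q) = cs.parab (cs.conjSet I p) := by
  have hlen : cs.length ρ = cs.length p + cs.length q := by rw [he, hq.length_mul hp]
  apply le_antisymm <;> apply parab_le_of_forall
  · rintro l ⟨hl, j, hj, hlj⟩
    refine ⟨l, ?_, rfl⟩
    have hpl : ¬ cs.length (p * cs.simple l) < cs.length p := by
      intro hlt
      have h1 := hJ j hj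
      have h2 : ρ * cs.simple j = p * cs.simple l * q := by
        rw [he, mul_assoc, ← hlj, mul_assoc]
      have h3 := cs.length_mul_le (p * cs.simple l) q
      rw [h2] at h1
      omega
    obtain ⟨m, hm, hmI⟩ := exists_longest hI
    have hmL := parab_mono (cs := cs) (Set.subset_insert i₀ I) hm
    have hmp := leftDescent_longest_mul hJ h hi hm hmI hp hq he
    have h1 := (isPrefix_of_forall_leftDescent hmp
      (mul_mem (mul_mem hmL hp) (simple_mem_parab hl))).length_le
    have h2 := cs.length_mul_simple_ne (m * p) l
    have h3 := (cs.rightInversion_mul_iff (a := m) (b := p) (cs.isReflection_simple l)).1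
      (by omega)
    have hrefl : cs.IsReflection (p * cs.simple l * p⁻¹) := (cs.isReflection_simple l).conj p
    have h4 : cs.length (m * (p * cs.simple l * p⁻¹)) < cs.length m := by
      by_contra h5
      exact hpl (h3.2 h5)
    have ht : p * cs.simple l * p⁻¹ ∈ cs.parab I := by
      refine mem_parab_of_leftInversion (inv_mem hm) hrefl ?_
      rwa [← cs.length_inv, mul_inv_rev, inv_inv, hrefl.inv, cs.length_inv]
    have hpI : cs.LeftReduced I p := (LeftReduced.of_conj hJ h).mono (by
      rw [he, isPrefix_mul_iff, ← he, hlen])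
    obtain ⟨i, hi, hie⟩ := hpI.exists_simple (k := l) ht (by simp [mul_assoc])
    exact ⟨i, hi, by rw [← hie]; simp [mul_assoc]⟩
  · rintro k ⟨i, hiI, hik⟩
    obtain ⟨j, hj, hij⟩ := h i hiI
    have h1 : cs.simple k * q = q * cs.simple j := by
      rw [he, ← mul_assoc, hik, mul_assoc, mul_assoc] at hij
      exact mul_left_cancel hij
    have h2 : cs.simple k ∈ cs.parab (insert i₀ I) := by
      have h3 : cs.simple k = p⁻¹ * cs.simple i * p := by
        rw [mul_assoc, hik, inv_mul_cancel_left]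
      rw [h3]
      exact mul_mem (mul_mem (inv_mem hp) (simple_mem_parab (Set.mem_insert_of_mem _ hiI))) hp
    obtain ⟨l, hl, hkl⟩ := exists_eq_simple_of_mem_parab h2 (cs.length_simple k)
    exact ⟨l, ⟨hl, j, hj, by rw [← hkl, h1]⟩, hkl⟩

end CoxeterSystem

namespace Bldg

open CoxeterSystem

variable {cs : CoxeterSystem M W} (X : Bldg cs)

/-! ### The Weyl distance -/

theorem delta_self (C : X.Chamber) : X.delta C C = 1 := (X.delta_eq_one_iff C C).2 rfl

variable {X}

theorem delta_symm_of_simple {D E : X.Chamber} {i : B} (h : X.delta D E = cs.simple i) :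
    X.delta E D = cs.simple i := by
  rcases X.delta_mem_pair E D E i h with h1 | h1
  · rw [X.delta_self] at h1
    rw [eq_comm, mul_eq_one_iff_eq_inv, inv_simple] at h1
    exact h1
  · rw [X.delta_self, eq_comm, X.delta_eq_one_iff] at h1
    subst h1
    rw [← h, X.delta_self]

theorem exists_rightPeel (C E : X.Chamber) (i : B) :
    ∃ D, X.delta C D = X.delta C E * cs.simple i ∧ X.delta D E = cs.simple i := by
  obtain ⟨D, h1, h2⟩ := X.exists_delta C E i
  exact ⟨D, h2, delta_symm_of_simple h1⟩

theorem delta_mul {C D E : X.Chamber}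
    (h : cs.length (X.delta C D * X.delta D E) =
      cs.length (X.delta C D) + cs.length (X.delta D E)) :
    X.delta C E = X.delta C D * X.delta D E := by
  generalize hn : cs.length (X.delta D E) = n
  induction n generalizing E with
  | zero =>
    rw [cs.length_eq_zero_iff, X.delta_eq_one_iff] at hn
    subst hn
    rw [X.delta_self, mul_one]
  | succ n ih =>
    obtain ⟨b, i, hb, hbn, hb'⟩ := exists_right_factor hn
    obtain ⟨F, h1, h2⟩ := exists_rightPeel D E i
    rw [← hb'] at h1
    have h3 := cs.length_mul_le (X.delta C D) b
    have h4 := cs.length_mul_le (X.delta C D * b) (cs.simple i)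
    rw [mul_assoc, ← hb, cs.length_simple] at h4
    have h5 := ih (E := F) (by rw [h1]; omega) (by rw [h1, hbn])
    rw [h1] at h5
    rw [hb, ← mul_assoc, ← h5]
    refine X.delta_eq_of_length C F E i h2 ?_
    rw [h5, mul_assoc, ← hb]
    omega

theorem delta_inv (C D : X.Chamber) : X.delta D C = (X.delta C D)⁻¹ := by
  generalize hn : cs.length (X.delta C D) = n
  induction n generalizing D with
  | zero =>
    rw [cs.length_eq_zero_iff, X.delta_eq_one_iff] at hn
    subst hn
    simp [X.delta_self]
  | succ n ih =>
    obtain ⟨b, i, hb, hbn, hb'⟩ := exists_right_factor hn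
    obtain ⟨F, h1, h2⟩ := exists_rightPeel C D i
    rw [← hb'] at h1
    have h3 := ih F (by rw [h1, hbn])
    have h4 := delta_symm_of_simple h2
    have h5 : cs.simple i * b⁻¹ = (X.delta C D)⁻¹ := by rw [hb, mul_inv_rev, inv_simple]
    rw [delta_mul (D := F), h4, h3, h1, h5]
    rw [h4, h3, h1, h5, cs.length_inv, cs.length_inv, cs.length_simple]
    omega

theorem exists_split {C E : X.Chamber} {a b : W} (h : X.delta C E = a * b)
    (hl : cs.length (a * b) = cs.length a + cs.length b) :
    ∃ D, X.delta C D = a ∧ X.delta D E = b := by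
  generalize hn : cs.length b = n
  induction n generalizing b E with
  | zero =>
    rw [cs.length_eq_zero_iff] at hn
    subst hn
    exact ⟨E, by simpa using h, X.delta_self E⟩
  | succ n ih =>
    obtain ⟨b', i, hb, hbn, hb'⟩ := exists_right_factor hn
    obtain ⟨F, h1, h2⟩ := exists_rightPeel C E i
    rw [h, mul_assoc, ← hb'] at h1
    have h3 := cs.length_mul_le a b'
    have h4 := cs.length_mul_le (a * b') (cs.simple i)
    rw [mul_assoc, ← hb, cs.length_simple] at h4
    obtain ⟨D, hD1, hD2⟩ := ih h1 (by omega) hbn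
    refine ⟨D, hD1, ?_⟩
    rw [X.delta_eq_of_length D F E i h2, hD2, ← hb]
    rw [hD2, ← hb]
    omega

theorem eq_of_split {C D D' E : X.Chamber} (h : X.delta C D = X.delta C D')
    (h' : X.delta D E = X.delta D' E)
    (hl : cs.length (X.delta C D * X.delta D E) =
      cs.length (X.delta C D) + cs.length (X.delta D E)) : D = D' := by
  generalize hn : cs.length (X.delta D E) = n
  induction n generalizing E with
  | zero =>
    rw [cs.length_eq_zero_iff] at hn
    rw [hn] at h'
    rw [X.delta_eq_one_iff] at hn
    rw [hn, (X.delta_eq_one_iff D' E).1 h'.symm]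
  | succ n ih =>
    obtain ⟨b, i, hb, hbn, hb'⟩ := exists_right_factor hn
    obtain ⟨F, h1, h2⟩ := exists_rightPeel D E i
    obtain ⟨F', h1', h2'⟩ := exists_rightPeel D' E i
    rw [← h', ← hb'] at h1'
    rw [← hb'] at h1
    have h3 := cs.length_mul_le (X.delta C D) b
    have h4 := cs.length_mul_le (X.delta C D * b) (cs.simple i)
    rw [mul_assoc, ← hb, cs.length_simple] at h4
    have hF : X.delta C F = X.delta C D * b := by
      rw [delta_mul (D := D), h1]
      rw [h1]; omega
    have hF' : X.delta C F' = X.delta C D * b := by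
      rw [delta_mul (D := D'), h1', h]
      rw [h1', ← h]; omega
    have hFF : F = F' := by
      rcases X.delta_mem_pair F E F' i (delta_symm_of_simple h2') with h5 | h5
      · rw [h2, simple_mul_simple_self, X.delta_eq_one_iff] at h5
        exact h5
      · rw [h2] at h5
        exfalso
        have h6 := X.delta_eq_of_length C F F' i h5 (by
          rw [hF, mul_assoc, ← hb]; omega)
        rw [hF, hF'] at h6
        have h7 := cs.length_mul_simple_ne (X.delta C D * b) i
        rw [← h6] at h7
        exact h7 rfl
    subst hFF
    exact ih (E := F) (h1.trans h1'.symm) (by rw [h1]; omega) (by rw [h1, hbn])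

theorem exists_delta_eq (C : X.Chamber) (w : W) : ∃ D, X.delta C D = w := by
  induction w using cs.simple_induction_right with
  | one => exact ⟨C, X.delta_self C⟩
  | mul_simple_right w i ih =>
    obtain ⟨D, rfl⟩ := ih
    obtain ⟨E, -, hE⟩ := X.exists_delta C D i
    exact ⟨E, hE⟩

theorem delta_mem_parab {I : Set B} {C D E : X.Chamber} (h : X.delta C D ∈ cs.parab I)
    (h' : X.delta D E ∈ cs.parab I) : X.delta C E ∈ cs.parab I := by
  generalize hn : cs.length (X.delta D E) = n
  induction n generalizing E with
  | zero =>
    rw [cs.length_eq_zero_iff, X.delta_eq_one_iff] at hn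
    rwa [← hn]
  | succ n ih =>
    obtain ⟨i, hi, hlt⟩ := exists_leftDescent_of_mem_parab (inv_mem h') (by
      intro h1
      rw [← cs.length_inv, h1] at hn
      simp at hn)
    rw [← cs.length_inv, mul_inv_rev, inv_inv, inv_simple, cs.length_inv] at hlt
    obtain ⟨F, h1, h2⟩ := exists_rightPeel D E i
    have h3 := ih (E := F) (by rw [h1]; exact mul_mem h' (simple_mem_parab hi)) (by
      have := cs.length_mul_simple (X.delta D E) i
      rw [h1]; omega)
    rcases X.delta_mem_pair C F E i h2 with h4 | h4
    · rw [h4]; exact mul_mem h3 (simple_mem_parab hi)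
    · rwa [h4]

/-! ### Residues and gates -/

theorem mem_residue {I : Set B} {C D : X.Chamber} :
    D ∈ X.residue I C ↔ X.delta C D ∈ cs.parab I := Iff.rfl

theorem self_mem_residue (I : Set B) (C : X.Chamber) : C ∈ X.residue I C := by
  rw [mem_residue, X.delta_self]; exact one_mem _

theorem residue_eq_of_mem {I : Set B} {C D : X.Chamber} (h : D ∈ X.residue I C) :
    X.residue I D = X.residue I C := by
  ext E
  rw [mem_residue] at h
  refine ⟨fun hE => delta_mem_parab h hE, fun hE => delta_mem_parab ?_ hE⟩
  rw [delta_inv]; exact inv_mem h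

theorem delta_mem_of_mem_residue {I : Set B} {C D E : X.Chamber} (hD : D ∈ X.residue I C)
    (hE : E ∈ X.residue I C) : X.delta D E ∈ cs.parab I := by
  rwa [← residue_eq_of_mem hD] at hE

theorem residue_congr {I J : Set B} (h : cs.parab I = cs.parab J) (C : X.Chamber) :
    X.residue I C = X.residue J C := by
  ext D; rw [mem_residue, mem_residue, h]

theorem residue_mono {I J : Set B} (h : I ⊆ J) (C : X.Chamber) :
    X.residue I C ⊆ X.residue J C := fun _ hD => parab_mono h hD

theorem parab_eq_of_residue_eq {I J : Set B} {C D : X.Chamber}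
    (h : X.residue I C = X.residue J D) : cs.parab I = cs.parab J := by
  have h1 : X.residue I C = X.residue J C :=
    h.trans (residue_eq_of_mem (h ▸ self_mem_residue I C)).symm
  ext w
  obtain ⟨E, rfl⟩ := exists_delta_eq C w
  rw [← mem_residue, h1, mem_residue]

theorem gdist_of_rightReduced {J : Set B} {C c D : X.Chamber} (hD : D ∈ X.residue J C)
    (hr : cs.RightReduced J (X.delta c D)) {E : X.Chamber} (hE : E ∈ X.residue J C) :
    X.gdist c E = X.gdist c D + X.gdist D E := by
  have h := hr.length_mul (delta_mem_of_mem_residue hD hE)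
  rw [gdist, delta_mul h, h, gdist, gdist]

theorem gate_eq {J : Set B} {C c D : X.Chamber} (hD : D ∈ X.residue J C)
    (hr : cs.RightReduced J (X.delta c D)) : X.gate (X.residue J C) c = D := by
  have h := Classical.epsilon_spec (p := fun D => D ∈ X.residue J C ∧
    ∀ E ∈ X.residue J C, X.gdist c E = X.gdist c D + X.gdist D E)
    ⟨D, hD, fun E hE => gdist_of_rightReduced hD hr hE⟩
  change X.gate (X.residue J C) c ∈ _ ∧ _ at h
  have h1 := h.2 D hD
  have h2 := gdist_of_rightReduced hD hr h.1
  have h3 : X.gdist D (X.gate (X.residue J C) c) = 0 := by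
    change X.gdist c D = X.gdist c (X.gate (X.residue J C) c) + _ at h1
    omega
  rw [gdist, cs.length_eq_zero_iff, X.delta_eq_one_iff] at h3
  exact h3.symm

theorem gate_spec (J : Set B) (C c : X.Chamber) :
    X.gate (X.residue J C) c ∈ X.residue J C ∧
      cs.RightReduced J (X.delta c (X.gate (X.residue J C) c)) := by
  obtain ⟨q, p, hp, he, hq⟩ := exists_rightReduced_mul (cs := cs) J (X.delta c C)
  obtain ⟨D, hD1, hD2⟩ := exists_split he (hq.length_mul hp)
  have hD : D ∈ X.residue J C := by
    rw [mem_residue, delta_inv, hD2]; exact inv_mem hp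
  rw [← hD1] at hq
  rw [gate_eq hD hq]
  exact ⟨hD, hq⟩

theorem delta_gate_mul {J : Set B} {C c E : X.Chamber} (hE : E ∈ X.residue J C) :
    X.delta c E = X.delta c (X.gate (X.residue J C) c) *
      X.delta (X.gate (X.residue J C) c) E := by
  obtain ⟨h1, h2⟩ := gate_spec J C c
  exact delta_mul (h2.length_mul (delta_mem_of_mem_residue h1 hE))

variable (X) in
/-- The Weyl distance from a chamber to its gate on `R`. -/
def rho (R : Set X.Chamber) (d : X.Chamber) : W := X.delta d (X.gate R d)

theorem rho_rightReduced (J : Set B) (C d : X.Chamber) :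
    cs.RightReduced J (X.rho (X.residue J C) d) := (gate_spec J C d).2

variable (X) in
/-- Some minimal gallery from `d` to its gate on `R` passes through `e`. -/
def FlowAt (R : Set X.Chamber) (d e : X.Chamber) : Prop :=
  X.rho R d = X.delta d e * X.rho R e ∧
    cs.length (X.rho R d) = cs.length (X.delta d e) + cs.length (X.rho R e)

theorem FlowAt.isPrefix {R : Set X.Chamber} {d e : X.Chamber} (h : X.FlowAt R d e) :
    cs.IsPrefix (X.delta d e) (X.rho R d) := by
  rw [h.1, isPrefix_mul_iff, ← h.1, h.2]

theorem FlowAt.delta_mul {R : Set X.Chamber} {d e f : X.Chamber} (h : X.FlowAt R d e)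
    (h' : X.FlowAt R e f) : X.delta d f = X.delta d e * X.delta e f := by
  apply Bldg.delta_mul
  have h1 := cs.length_mul_le (X.delta d e) (X.delta e f)
  have h2 := cs.length_mul_le (X.delta d e * X.delta e f) (X.rho R f)
  rw [mul_assoc, ← h'.1, ← h.1] at h2
  have h3 := h.2
  have h4 := h'.2
  omega

theorem FlowAt.trans {R : Set X.Chamber} {d e f : X.Chamber} (h : X.FlowAt R d e)
    (h' : X.FlowAt R e f) : X.FlowAt R d f := by
  have h0 := h.delta_mul h'
  have h1 := cs.length_mul_le (X.delta d e) (X.delta e f)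
  have h2 := cs.length_mul_le (X.delta d f) (X.rho R f)
  have h5 : X.rho R d = X.delta d f * X.rho R f := by rw [h.1, h'.1, h0, mul_assoc]
  refine ⟨h5, ?_⟩
  rw [← h5] at h2
  rw [← h0] at h1
  have h3 := h.2
  have h4 := h'.2
  omega

theorem FlowAt.gate_eq {J : Set B} {C d e : X.Chamber} (h : X.FlowAt (X.residue J C) d e) :
    X.gate (X.residue J C) e = X.gate (X.residue J C) d := by
  symm
  have hr := rho_rightReduced J C d
  obtain ⟨h1, h2⟩ := h
  refine Bldg.gate_eq (gate_spec J C e).1 ?_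
  rwa [Bldg.delta_mul (D := e) (by rw [← rho, ← h1, h2]), ← rho, ← h1]

theorem FlowAt.eq {J : Set B} {C c e e' : X.Chamber} (h : X.FlowAt (X.residue J C) c e)
    (h' : X.FlowAt (X.residue J C) c e') (hd : X.delta c e = X.delta c e') : e = e' := by
  refine eq_of_split (E := X.gate (X.residue J C) c) hd ?_ ?_
  · rw [← h.gate_eq, ← rho, h.gate_eq, ← h'.gate_eq, ← rho]
    exact mul_left_cancel (h.1.symm.trans (h'.1.trans (by rw [hd])))
  · rw [← h.gate_eq, ← rho, ← h.1, h.2]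

theorem flowAt_gate {L J : Set B} {c₀ C c : X.Chamber} (hc : c ∈ X.residue L c₀) :
    X.FlowAt (X.residue J C) c (X.gate (X.residue L c₀) (X.gate (X.residue J C) c)) ∧
      cs.LeftReduced L (X.rho (X.residue J C)
        (X.gate (X.residue L c₀) (X.gate (X.residue J C) c))) := by
  set E := X.gate (X.residue J C) c with hE
  obtain ⟨hd, hr⟩ := gate_spec L c₀ E
  set d := X.gate (X.residue L c₀) E with hdE
  have hl : cs.LeftReduced L (X.delta d E) := by
    rw [delta_inv E d]; exact leftReduced_inv_iff.2 hr
  have hlen := hl.length_mul (delta_mem_of_mem_residue hc hd)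
  have hmul := delta_mul hlen
  have hrr : cs.RightReduced J (X.delta c E) := rho_rightReduced J C c
  have hg : X.gate (X.residue J C) d = E := by
    refine gate_eq (gate_spec J C c).1 (RightReduced.of_mul (a := X.delta c d) ?_ hlen)
    rwa [← hmul]
  have hrho : X.rho (X.residue J C) d = X.delta d E := by rw [rho, hg]
  have hrhoc : X.rho (X.residue J C) c = X.delta c E := by rw [rho]
  exact ⟨⟨by rw [hrho, hrhoc, hmul], by rw [hrho, hrhoc, hmul, hlen]⟩, by rwa [hrho]⟩

variable (X) in
/-- The `I`-residue of `d` is parallel to a residue contained in `R`, the latter having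
type `J`. -/
def TightAt (R : Set X.Chamber) (J I : Set B) (d : X.Chamber) : Prop :=
  ∀ i ∈ I, ∃ j ∈ J, cs.simple i * X.rho R d = X.rho R d * cs.simple j

theorem TightAt.gate_spec {J I : Set B} {C d d' : X.Chamber}
    (h : X.TightAt (X.residue J C) J I d) (hd : d' ∈ X.residue I d) :
    X.rho (X.residue J C) d' = X.rho (X.residue J C) d := by
  set q := X.rho (X.residue J C) d with hq
  have hr : cs.RightReduced J q := rho_rightReduced J C d
  have hl : cs.LeftReduced I q := LeftReduced.of_conj hr h
  have hw : X.delta d' d ∈ cs.parab I := by rw [delta_inv]; exact inv_mem hd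
  have h1 : X.delta d' (X.gate (X.residue J C) d) = X.delta d' d * q :=
    delta_mul (hl.length_mul hw)
  have hb := conj_mem_parab h hw
  rw [show X.delta d' d * q = q * (q⁻¹ * X.delta d' d * q) by group] at h1
  obtain ⟨C', hC1, hC2⟩ := exists_split h1 (hr.length_mul hb)
  have hC : C' ∈ X.residue J C := by
    rw [← residue_eq_of_mem (Bldg.gate_spec J C d).1, mem_residue, delta_inv, hC2]
    exact inv_mem hb
  rw [rho, gate_eq hC (by rwa [hC1]), hC1]

theorem TightAt.congr {J I : Set B} {C d d' : X.Chamber}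
    (h : X.TightAt (X.residue J C) J I d) (hd : d' ∈ X.residue I d) :
    X.TightAt (X.residue J C) J I d' := by
  unfold TightAt
  rwa [h.gate_spec hd]

theorem TightAt.finite {J I : Set B} {R : Set X.Chamber} {d : X.Chamber}
    (h : X.TightAt R J I d) (hJ : SphType cs J) : SphType cs I :=
  finite_parab_of_conj hJ h

theorem projSet_eq {L J : Set B} {C d : X.Chamber}
    (hl : cs.LeftReduced L (X.rho (X.residue J C) d)) :
    X.projSet (X.residue L d) (X.residue J C) =
      X.residue (cs.tightSet J L (X.rho (X.residue J C) d)) d := by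
  set q := X.rho (X.residue J C) d with hq
  have hr : cs.RightReduced J q := rho_rightReduced J C d
  have hKL : cs.tightSet J L q ⊆ L := fun i hi => hi.1
  obtain ⟨hE, -⟩ := gate_spec J C d
  apply Set.Subset.antisymm
  · rintro _ ⟨C', hC', rfl⟩
    obtain ⟨a, ha, c, hc, he, hlc⟩ :=
      hl.exists_double_coset_decomp hr (delta_mem_of_mem_residue hE hC')
    have h1 : X.delta d C' = q * X.delta (X.gate (X.residue J C) d) C' := delta_gate_mul hC'
    rw [he] at h1
    have haL := parab_mono (cs := cs) hKL ha
    obtain ⟨d', h2, h3⟩ := exists_split h1 (hlc.length_mul haL)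
    rw [gate_eq (D := d') (by rwa [mem_residue, h2])
      (by rwa [delta_inv d', h3, ← leftReduced_inv_iff, inv_inv]), mem_residue, h2]
    exact ha
  · intro d' hd'
    have ht : X.TightAt (X.residue J C) J (cs.tightSet J L q) d := fun i hi => hi.2
    have h1 := ht.gate_spec hd'
    refine ⟨X.gate (X.residue J C) d', (gate_spec J C d').1, gate_eq (residue_mono hKL d hd') ?_⟩
    rw [rho] at h1
    rw [delta_inv d', h1, ← leftReduced_inv_iff, inv_inv]
    exact hl

/-- The gate of `c` on `proj_σ R` is the projection to `σ` of the gate of `c` on `R`. -/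
theorem gate_projSet {L J : Set B} {c₀ C c : X.Chamber} (hc : c ∈ X.residue L c₀) :
    X.gate (X.projSet (X.residue L c₀) (X.residue J C)) c =
      X.gate (X.residue L c₀) (X.gate (X.residue J C) c) := by
  obtain ⟨⟨hf1, hf2⟩, hl⟩ := flowAt_gate (J := J) (C := C) hc
  have hd := (gate_spec L c₀ (X.gate (X.residue J C) c)).1
  set d := X.gate (X.residue L c₀) (X.gate (X.residue J C) c)
  rw [← residue_eq_of_mem hd, projSet_eq hl]
  refine gate_eq (self_mem_residue _ _) ?_
  rintro k ⟨hk, j, hj, he⟩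
  have h1 := rho_rightReduced J C c j hj
  have h2 := cs.length_mul_le (X.delta c d * cs.simple k) (X.rho (X.residue J C) d)
  rw [mul_assoc, he, ← mul_assoc, ← hf1] at h2
  omega

/-- A projection of a spherical residue is a spherical residue. -/
theorem projRes_val (σ R : X.Res) : (X.projRes σ R).1 = X.projSet σ.1 R.1 := by
  refine Classical.epsilon_spec (p := fun U : X.Res => U.1 = X.projSet σ.1 R.1) ?_
  obtain ⟨_, L, c, hL, rfl⟩ := σ
  obtain ⟨_, J, C, hJ, rfl⟩ := R
  have hl := (flowAt_gate (J := J) (C := C) (self_mem_residue L c)).2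
  have hd := (gate_spec L c (X.gate (X.residue J C) c)).1
  set d := X.gate (X.residue L c) (X.gate (X.residue J C) c)
  refine ⟨⟨_, cs.tightSet J L (X.rho (X.residue J C) d), d, ?_, rfl⟩, ?_⟩
  · exact hL.subset (parab_mono (cs := cs) fun i hi => hi.1)
  · dsimp only
    rw [← residue_eq_of_mem hd, projSet_eq hl]

end Bldg

namespace CoxeterSystem

variable {cs : CoxeterSystem M W}

theorem conjSet_conjSet {I L : Set B} {p q : W} (hI : I ⊆ L) (hp : p ∈ cs.parab L)
    (hq : cs.LeftReduced L q) : cs.conjSet (cs.conjSet I p) q = cs.conjSet I (p * q) := by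
  ext k
  constructor
  · rintro ⟨j, ⟨i, hi, hj⟩, hk⟩
    exact ⟨i, hi, by rw [← mul_assoc, hj, mul_assoc, hk, mul_assoc]⟩
  · rintro ⟨i, hi, hk⟩
    have h1 : p⁻¹ * cs.simple i * p * q = q * cs.simple k := by
      simp only [mul_assoc] at hk ⊢
      rw [hk, inv_mul_cancel_left]
    obtain ⟨l, -, hl⟩ := hq.exists_simple
      (mul_mem (mul_mem (inv_mem hp) (simple_mem_parab (hI hi))) hp) h1
    refine ⟨l, ⟨i, hi, ?_⟩, by rw [← hl, h1]⟩
    rw [← hl]; simp [mul_assoc]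

theorem parab_conjSet_one (I : Set B) : cs.parab (cs.conjSet I 1) = cs.parab I := by
  apply le_antisymm <;> apply parab_le_of_forall
  · rintro k ⟨i, hi, he⟩
    exact ⟨i, hi, by simpa using he.symm⟩
  · intro i hi
    exact ⟨i, ⟨i, hi, by simp⟩, rfl⟩

end CoxeterSystem

namespace Bldg

open CoxeterSystem

variable {cs : CoxeterSystem M W} {X : Bldg cs}

/-! ### Flowing towards a sequence of residues -/

theorem FlowAt.tightAt {R : Set X.Chamber} {J I : Set B} {d e : X.Chamber}
    (h : X.FlowAt R d e) (ht : X.TightAt R J I d) :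
    X.TightAt R J (cs.conjSet I (X.delta d e)) e := by
  rintro k ⟨i, hi, hk⟩
  obtain ⟨j, hj, he⟩ := ht i hi
  refine ⟨j, hj, ?_⟩
  rw [h.1, ← mul_assoc, hk, mul_assoc, mul_assoc] at he
  exact mul_left_cancel he

/-- A flow can be transported along parallel residues. -/
theorem FlowAt.exists_parallel {J : ℕ → Set B} {C : ℕ → X.Chamber} {I : Set B}
    {d d' e : X.Chamber}
    (ht : ∀ᶠ n in atTop, X.TightAt (X.residue (J n) (C n)) (J n) I d)
    (hf : ∀ᶠ n in atTop, X.FlowAt (X.residue (J n) (C n)) d e)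
    (hy : ∀ i ∈ I, ∃ k, cs.simple i * X.delta d e = X.delta d e * cs.simple k)
    (hd : d' ∈ X.residue I d) :
    ∃ e' ∈ X.residue (cs.conjSet I (X.delta d e)) e,
      ∀ᶠ n in atTop, X.FlowAt (X.residue (J n) (C n)) d' e' := by
  set y := X.delta d e with hyd
  have hy' : ∀ i ∈ I, ∃ k ∈ cs.conjSet I y, cs.simple i * y = y * cs.simple k := by
    intro i hi
    obtain ⟨k, hk⟩ := hy i hi
    exact ⟨k, ⟨i, hi, hk⟩, hk⟩
  obtain ⟨n, htn, hfn⟩ := (ht.and hf).exists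
  have hl : cs.LeftReduced I y :=
    (LeftReduced.of_conj (rho_rightReduced (J n) (C n) d) htn).mono hfn.isPrefix
  have hr : cs.RightReduced (cs.conjSet I y) y :=
    RightReduced.of_conj hl fun k ⟨i, hi, he⟩ => ⟨i, hi, he⟩
  have hw : X.delta d' d ∈ cs.parab I := by rw [delta_inv]; exact inv_mem hd
  have h1 : X.delta d' e = X.delta d' d * y := Bldg.delta_mul (hl.length_mul hw)
  have hb := conj_mem_parab hy' hw
  rw [show X.delta d' d * y = y * (y⁻¹ * X.delta d' d * y) by group] at h1
  obtain ⟨e', h2, h3⟩ := exists_split h1 (hr.length_mul hb)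
  have he' : e' ∈ X.residue (cs.conjSet I y) e := by
    rw [mem_residue, delta_inv, h3]; exact inv_mem hb
  refine ⟨e', he', ?_⟩
  filter_upwards [ht, hf] with n htn hfn
  rw [FlowAt, htn.gate_spec hd, (hfn.tightAt htn).gate_spec he', h2]
  exact hfn

variable (X) in
/-- The residues obtained from `x` by passing to smaller residues in the order of `Res(X)` and by
projecting `ξ`. -/
inductive Reach (ξ : X.Res → X.Res) (x : X.Res) : X.Res → Prop
  | refl : Reach ξ x x
  | sup {z τ : X.Res} : Reach ξ x z → z.1 ⊆ τ.1 → Reach ξ x τ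
  | lim {z : X.Res} : Reach ξ x z → Reach ξ x (ξ z)

theorem Reach.trans {ξ : X.Res → X.Res} {x y z : X.Res} (h : X.Reach ξ x y)
    (h' : X.Reach ξ y z) : X.Reach ξ x z := by
  induction h' with
  | refl => exact h
  | sup _ hs ih => exact ih.sup hs
  | lim _ ih => exact ih.lim

variable (X) in
/-- The limit of the sequence of residues `R_n`, of type `J_n` and containing `C_n`, is `ξ`. -/
def HasLim (J : ℕ → Set B) (C : ℕ → X.Chamber) (ξ : X.Res → X.Res) : Prop :=
  ∀ σ : X.Res, ∀ᶠ n in atTop, (ξ σ).1 = X.projSet σ.1 (X.residue (J n) (C n))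

variable {J : ℕ → Set B} {C : ℕ → X.Chamber} {ξ : X.Res → X.Res}

theorem HasLim.exists_flow (H : X.HasLim J C ξ) {σ : X.Res} {L : Set B} {c : X.Chamber}
    (hσ : σ.1 = X.residue L c) :
    ∃ e ∈ X.residue L c, ∀ᶠ n in atTop, X.FlowAt (X.residue (J n) (C n)) c e ∧
      cs.LeftReduced L (X.rho (X.residue (J n) (C n)) e) ∧
      (ξ σ).1 = X.residue (cs.tightSet (J n) L (X.rho (X.residue (J n) (C n)) e)) e := by
  have hH := H σ
  rw [hσ] at hH
  have hc := self_mem_residue L c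
  have key : ∀ᶠ n in atTop, X.gate (ξ σ).1 c ∈ X.residue L c ∧
      X.FlowAt (X.residue (J n) (C n)) c (X.gate (ξ σ).1 c) ∧
      cs.LeftReduced L (X.rho (X.residue (J n) (C n)) (X.gate (ξ σ).1 c)) ∧
      (ξ σ).1 = X.residue (cs.tightSet (J n) L (X.rho (X.residue (J n) (C n))
        (X.gate (ξ σ).1 c))) (X.gate (ξ σ).1 c) := by
    filter_upwards [hH] with n hn
    have hg : X.gate (ξ σ).1 c = X.gate (X.residue L c) (X.gate (X.residue (J n) (C n)) c) := by
      rw [hn]; exact gate_projSet hc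
    obtain ⟨h1, h2⟩ := flowAt_gate (J := J n) (C := C n) hc
    have h3 := (gate_spec L c (X.gate (X.residue (J n) (C n)) c)).1
    rw [hg]
    refine ⟨h3, h1, h2, ?_⟩
    rw [hn, ← projSet_eq h2, residue_eq_of_mem h3]
  obtain ⟨n, hn, -⟩ := key.exists
  exact ⟨_, hn, key.mono fun n hn => hn.2⟩

variable (X) in
/-- The residue `z` is eventually parallel to a residue contained in `R_n`, and it meets
minimal galleries from `c` to `R_n`. -/
def Meets (J : ℕ → Set B) (C : ℕ → X.Chamber) (z : X.Res) (c : X.Chamber) : Prop :=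
  ∃ I d, SphType cs I ∧ z.1 = X.residue I d ∧
    (∀ᶠ n in atTop, X.TightAt (X.residue (J n) (C n)) (J n) I d) ∧
    ∀ᶠ n in atTop, X.FlowAt (X.residue (J n) (C n)) c d

theorem HasLim.meets (H : X.HasLim J C ξ) {σ : X.Res} {c : X.Chamber} (hc : c ∈ σ.1) :
    X.Meets J C (ξ σ) c := by
  obtain ⟨L, c₀, hL, hσ⟩ := σ.2
  rw [hσ] at hc
  rw [← residue_eq_of_mem hc] at hσ
  obtain ⟨e, -, he⟩ := H.exists_flow hσ
  obtain ⟨N, -, -, hN⟩ := he.exists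
  refine ⟨_, e, hL.subset (parab_mono (cs := cs) fun i hi => hi.1), hN, ?_,
    he.mono fun n hn => hn.1⟩
  filter_upwards [he] with n hn i hi
  have h1 := parab_eq_of_residue_eq (hN.symm.trans hn.2.2)
  have h2 : cs.simple i ∈ cs.parab _ := h1 ▸ simple_mem_parab hi
  obtain ⟨k, ⟨-, j, hj, hkj⟩, hk⟩ := exists_eq_simple_of_mem_parab h2 (cs.length_simple i)
  exact ⟨j, hj, by rw [hk, hkj]⟩

theorem HasLim.exists_reach (H : X.HasLim J C ξ) {I : Set B} {d : X.Chamber} {y : W}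
    (hI : SphType cs I)
    (ht : ∀ᶠ n in atTop, X.TightAt (X.residue (J n) (C n)) (J n) I d)
    (hp : ∀ᶠ n in atTop, cs.IsPrefix y (X.rho (X.residue (J n) (C n)) d))
    (hy : ∀ i ∈ I, ∃ k, cs.simple i * y = y * cs.simple k) :
    ∃ e, X.delta d e = y ∧ (∀ᶠ n in atTop, X.FlowAt (X.residue (J n) (C n)) d e) ∧
      ∀ x z : X.Res, x.1 = X.residue I d → z.1 = X.residue (cs.conjSet I y) e →
        X.Reach ξ x z := by
  generalize hm : cs.length y = m
  induction m using Nat.strong_induction_on generalizing I d y with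
  | _ m ih =>
  by_cases h1 : y = 1
  · subst h1
    refine ⟨d, X.delta_self d, .of_forall fun n => ⟨by rw [X.delta_self, one_mul],
      by rw [X.delta_self, cs.length_one, zero_add]⟩, fun x z hx hz => ?_⟩
    rw [residue_congr (parab_conjSet_one I), ← hx] at hz
    rw [Subtype.ext hz]
    exact .refl
  obtain ⟨i₀, hi₀⟩ := cs.exists_leftDescent_of_ne_one h1
  have hi : cs.IsPrefix (cs.simple i₀) y := simple_isPrefix_iff.2 hi₀
  have hy' : ∀ i ∈ I, ∃ k ∈ cs.conjSet I y, cs.simple i * y = y * cs.simple k := by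
    intro i hi
    obtain ⟨k, hk⟩ := hy i hi
    exact ⟨k, ⟨i, hi, hk⟩, hk⟩
  obtain ⟨n, htn, hpn⟩ := (ht.and hp).exists
  have hr : cs.RightReduced (cs.conjSet I y) y := RightReduced.of_conj
    ((LeftReduced.of_conj (rho_rightReduced (J n) (C n) d) htn).mono hpn)
    fun k ⟨i, hi, he⟩ => ⟨i, hi, he⟩
  obtain ⟨p, hpL, q, he, hq⟩ := exists_mul_leftReduced (cs := cs) (insert i₀ I) y
  let τ : X.Res := ⟨X.residue (insert i₀ I) d, _, d, finite_parab_insert hI hr hy' hi, rfl⟩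
  obtain ⟨e₁, he₁, hev⟩ := H.exists_flow (σ := τ) rfl
  have hpart : p = X.delta d e₁ := by
    obtain ⟨n, ⟨hf, hl, -⟩, htn, hpn⟩ := (hev.and (ht.and hp)).exists
    exact parab_part_unique hI hr hy' hi hpL hq he (rho_rightReduced (J n) (C n) d) htn
      (hi.trans hpn) he₁ hl hf.1
  have hτ : (ξ τ).1 = X.residue (cs.conjSet I p) e₁ := by
    obtain ⟨n, ⟨hf, hl, hx⟩, htn, hpn⟩ := (hev.and (ht.and hp)).exists
    rw [hx]
    refine residue_congr ?_ e₁
    rw [hpart]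
    exact parab_tightSet_eq hI (rho_rightReduced (J n) (C n) d) htn (hi.trans hpn) he₁ hl hf.1
  have hlen := hq.length_mul hpL
  have hp1 : cs.length p ≠ 0 := by
    rw [Ne, cs.length_eq_zero_iff]
    rintro rfl
    have h2 := hq i₀ (Set.mem_insert _ _)
    rw [one_mul] at he
    rw [← he] at h2
    exact absurd hi₀ h2.not_gt
  obtain ⟨e, h2, h3, h4⟩ := ih (cs.length q) (by rw [← hm, he]; omega)
    (finite_parab_conjSet p hI)
    (by
      filter_upwards [hev, ht] with n hn htn
      rw [hpart]
      exact hn.1.tightAt htn)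
    (by
      filter_upwards [hev, hp] with n hn hpn
      have h2 := ((isPrefix_mul_iff.2 hlen).inv_mul (he ▸ hpn))
      rwa [inv_mul_cancel_left, hn.1.1, ← hpart, inv_mul_cancel_left] at h2)
    (by
      rintro k ⟨i, hi, hk⟩
      obtain ⟨j, hj⟩ := hy i hi
      refine ⟨j, ?_⟩
      rw [he, ← mul_assoc, hk, mul_assoc, mul_assoc] at hj
      exact mul_left_cancel hj) rfl
  refine ⟨e, ?_, ?_, fun x z hx hz => ?_⟩
  · obtain ⟨n, hn, hn'⟩ := (hev.and h3).exists
    rw [hn.1.delta_mul hn', h2, ← hpart, he]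
  · filter_upwards [hev, h3] with n hn hn'
    exact hn.1.trans hn'
  · refine .trans (.lim (.sup .refl (τ := τ) ?_)) (h4 (ξ τ) z hτ ?_)
    · rw [hx]
      exact residue_mono (Set.subset_insert _ _) d
    · rw [hz, he, conjSet_conjSet (Set.subset_insert i₀ I) hpL hq]

theorem HasLim.exists_reach_gcp (H : X.HasLim J C ξ) {I : Set B} {c d : X.Chamber} {v : W}
    {N : ℕ} (hv : cs.IsGcp (Set.range fun n : {n // N ≤ n} =>
      X.rho (X.residue (J n) (C n)) c) v) (hI : SphType cs I)
    (ht : ∀ n ≥ N, X.TightAt (X.residue (J n) (C n)) (J n) I d)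
    (hf : ∀ n ≥ N, X.FlowAt (X.residue (J n) (C n)) c d) :
    ∃ K e, SphType cs K ∧ X.delta c e = v ∧
      (∀ᶠ n in atTop, X.FlowAt (X.residue (J n) (C n)) c e) ∧
      (∀ᶠ n in atTop, X.TightAt (X.residue (J n) (C n)) (J n) K e) ∧
      (∀ x z : X.Res, x.1 = X.residue I d → z.1 = X.residue K e → X.Reach ξ x z) ∧
      ∀ d' ∈ X.residue I d, ∃ e' ∈ X.residue K e,
        ∀ᶠ n in atTop, X.FlowAt (X.residue (J n) (C n)) d' e' := by
  have hne : Nonempty {n // N ≤ n} := ⟨⟨N, le_rfl⟩⟩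
  have hpre : ∀ r ∈ Set.range fun n : {n // N ≤ n} => X.rho (X.residue (J n) (C n)) c,
      cs.IsPrefix (X.delta c d) r := by
    rintro _ ⟨n, rfl⟩
    exact (hf n n.2).isPrefix
  have hle := hv.2 _ hpre
  have hy := hv.inv_mul (Set.range_nonempty _) hpre
  rw [← Set.range_comp] at hy
  have hfun : ((fun r => (X.delta c d)⁻¹ * r) ∘ fun n : {n // N ≤ n} =>
      X.rho (X.residue (J n) (C n)) c) = fun n : {n // N ≤ n} => X.rho (X.residue (J n) (C n)) d := by
    funext n
    simp [(hf n n.2).1]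
  rw [hfun] at hy
  have hrib : ∀ i ∈ I, ∃ k, cs.simple i * ((X.delta c d)⁻¹ * v) =
      (X.delta c d)⁻¹ * v * cs.simple k := by
    intro i hi
    refine hy.exists_ribbon fun n => ⟨?_, ?_⟩
    · exact LeftReduced.of_conj (rho_rightReduced (J n) (C n) d) (ht n n.2) i hi
    · obtain ⟨j, -, hj⟩ := ht n n.2 i hi
      exact ⟨j, hj⟩
  have ht' := eventually_atTop.2 ⟨N, ht⟩
  have hf' := eventually_atTop.2 ⟨N, hf⟩
  obtain ⟨e, h1, h2, h3⟩ := H.exists_reach hI ht'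
    (eventually_atTop.2 ⟨N, fun n hn => hy.1 _ ⟨⟨n, hn⟩, rfl⟩⟩) hrib
  rw [← h1] at h3 hrib
  refine ⟨_, e, finite_parab_conjSet (X.delta d e) hI, ?_, ?_, ?_, h3, fun d' hd' =>
    FlowAt.exists_parallel ht' h2 hrib hd'⟩
  · obtain ⟨n, hn, hn'⟩ := (hf'.and h2).exists
    rw [hn.delta_mul hn', h1, mul_inv_cancel_left]
  · filter_upwards [hf', h2] with n hn hn'
    exact hn.trans hn'
  · filter_upwards [ht', h2] with n hn hn'
    exact hn'.tightAt hn

theorem HasLim.exists_reach_reach (H : X.HasLim J C ξ) {z₁ z₂ : X.Res} {c c' : X.Chamber}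
    (hJ : ∀ n, SphType cs (J n))
    (h₁ : X.Meets J C z₁ c) (h₂ : X.Meets J C z₂ c) (h₂' : X.Meets J C z₂ c') :
    ∃ z, X.Reach ξ z₁ z ∧ X.Reach ξ z₂ z ∧ X.Meets J C z c' := by
  obtain ⟨I₁, d₁, hI₁, hz₁, ht₁, hf₁⟩ := h₁
  obtain ⟨I₂, d₂, hI₂, hz₂, ht₂, hf₂⟩ := h₂
  obtain ⟨I', d', -, hz', -, hf'⟩ := h₂'
  obtain ⟨N, hN⟩ := eventually_atTop.1 ((ht₁.and hf₁).and (ht₂.and hf₂))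
  have hne : Nonempty {n // N ≤ n} := ⟨⟨N, le_rfl⟩⟩
  obtain ⟨v, hv⟩ := exists_isGcp (cs := cs) (Set.range_nonempty fun n : {n // N ≤ n} =>
    X.rho (X.residue (J n) (C n)) c)
  obtain ⟨K₁, e, hK₁, hv₁, hfe, hte₁, hr₁, -⟩ := H.exists_reach_gcp hv hI₁
    (fun n hn => (hN n hn).1.1) fun n hn => (hN n hn).1.2
  obtain ⟨K₂, e₂, hK₂, hv₂, hfe₂, hte₂, hr₂, hpar⟩ := H.exists_reach_gcp hv hI₂
    (fun n hn => (hN n hn).2.1) fun n hn => (hN n hn).2.2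
  obtain rfl : e = e₂ := by
    obtain ⟨n, hn, hn'⟩ := (hfe.and hfe₂).exists
    exact hn.eq hn' (hv₁.trans hv₂.symm)
  have ht : ∀ᶠ n in atTop, X.TightAt (X.residue (J n) (C n)) (J n) (K₁ ∪ K₂) e := by
    filter_upwards [hte₁, hte₂] with n h h' i hi
    exact hi.elim (h i) (h' i)
  have hfin : SphType cs (K₁ ∪ K₂) := by
    obtain ⟨n, hn⟩ := ht.exists
    exact hn.finite (hJ n)
  have hd' : d' ∈ X.residue I₂ d₂ := by
    rw [← hz₂, hz']; exact self_mem_residue _ _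
  obtain ⟨e', he', hfe'⟩ := hpar d' hd'
  have he'' : e' ∈ X.residue (K₁ ∪ K₂) e := residue_mono Set.subset_union_right e he'
  refine ⟨⟨X.residue (K₁ ∪ K₂) e, _, e, hfin, rfl⟩, ?_, ?_, _, e', hfin,
    (residue_eq_of_mem he'').symm, ?_, ?_⟩
  · exact (hr₁ z₁ ⟨X.residue K₁ e, _, e, hK₁, rfl⟩ hz₁ rfl).sup
      (residue_mono Set.subset_union_left e)
  · exact (hr₂ z₂ ⟨X.residue K₂ e, _, e, hK₂, rfl⟩ hz₂ rfl).sup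
      (residue_mono Set.subset_union_right e)
  · exact ht.mono fun n hn => hn.congr he''
  · filter_upwards [hf', hfe'] with n hn hn'
    exact hn.trans hn'

theorem sphType_singleton (i : B) : SphType cs {i} := by
  rw [SphType, Set.image_singleton, ← Subgroup.zpowers_eq_closure]
  refine finite_zpowers.2 (isOfFinOrder_iff_pow_eq_one.2 ⟨2, by norm_num, ?_⟩)
  rw [pow_two, simple_mul_simple_self]

theorem HasLim.exists_reach_meets (H : X.HasLim J C ξ) (hJ : ∀ n, SphType cs (J n))
    {x : X.Res} {c c' : X.Chamber} (h : ∃ z, X.Reach ξ x z ∧ X.Meets J C z c) :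
    ∃ z, X.Reach ξ x z ∧ X.Meets J C z c' := by
  generalize hn : cs.length (X.delta c c') = n
  induction n generalizing c' with
  | zero =>
    rw [cs.length_eq_zero_iff, X.delta_eq_one_iff] at hn
    rwa [← hn]
  | succ n ih =>
    obtain ⟨b, i, hb, hbn, hb'⟩ := exists_right_factor hn
    obtain ⟨f, h1, h2⟩ := exists_rightPeel c c' i
    obtain ⟨z, hz, hzf⟩ := ih (c' := f) (by rw [h1, ← hb', hbn])
    let σ : X.Res := ⟨X.residue {i} f, _, f, sphType_singleton i, rfl⟩
    have hf : f ∈ σ.1 := self_mem_residue _ f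
    have hc' : c' ∈ σ.1 := by
      change X.delta f c' ∈ cs.parab {i}
      rw [h2]; exact simple_mem_parab rfl
    obtain ⟨z', h3, -, h4⟩ := H.exists_reach_reach hJ hzf (H.meets hf) (H.meets hc')
    exact ⟨z', hz.trans h3, h4⟩

theorem Res.nonempty (x : X.Res) : x.1.Nonempty := by
  obtain ⟨_, I, c, -, rfl⟩ := x
  exact ⟨c, self_mem_residue I c⟩

theorem HasLim.exists_common_reach (H : X.HasLim J C ξ) (hJ : ∀ n, SphType cs (J n))
    (x y : X.Res) : ∃ z, X.Reach ξ x z ∧ X.Reach ξ y z := by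
  obtain ⟨c, hc⟩ := x.nonempty
  obtain ⟨c', hc'⟩ := y.nonempty
  obtain ⟨z, hz, hzc⟩ := H.exists_reach_meets hJ (c' := c') ⟨ξ x, .lim .refl, H.meets hc⟩
  have hy := H.meets hc'
  obtain ⟨w, h1, h2, -⟩ := H.exists_reach_reach hJ hzc hy hy
  exact ⟨w, hz.trans h1, .trans (.lim .refl) h2⟩

/-! ### Combinatorial sectors -/

theorem ConvSeq.eventually_eq {R : ℕ → X.Res} (h : X.ConvSeq ξ R) (σ : X.Res) :
    ∀ᶠ n in atTop, X.projRes σ (R n) = ξ σ := by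
  have h1 := tendsto_pi_nhds.1 h σ
  rw [nhds_discrete, tendsto_pure] at h1
  exact h1

theorem mem_Qseq {x z : X.Res} {R : ℕ → X.Res} :
    z ∈ X.Qseq x R ↔ ∀ᶠ n in atTop, z ∈ X.conv2 x (R n) := by
  simp [Qseq, eventually_atTop]

theorem convexResSet_convHull (𝓡 : Set X.Res) : X.ConvexResSet (X.convHull 𝓡) := by
  refine ⟨fun R₁ R₂ hle h 𝓢 h𝓢 => h𝓢.1.1 R₁ R₂ hle (h 𝓢 h𝓢), fun R₁ h₁ R₂ h₂ 𝓢 h𝓢 => ?_⟩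
  exact h𝓢.1.2 R₁ (h₁ 𝓢 h𝓢) R₂ (h₂ 𝓢 h𝓢)

theorem subset_convHull (𝓡 : Set X.Res) : 𝓡 ⊆ X.convHull 𝓡 :=
  Set.subset_sInter fun _ h => h.2

theorem convHull_subset {𝓡 𝓢 : Set X.Res} (h : X.ConvexResSet 𝓢) (h' : 𝓡 ⊆ 𝓢) :
    X.convHull 𝓡 ⊆ 𝓢 := Set.sInter_subset_of_mem ⟨h, h'⟩

theorem Reach.mem_Qseq {R : ℕ → X.Res} (hR : X.ConvSeq ξ R) {x z : X.Res}
    (h : X.Reach ξ x z) : z ∈ X.Qseq x R := by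
  induction h with
  | refl =>
    exact Bldg.mem_Qseq.2 (.of_forall fun n => subset_convHull _ (Set.mem_insert _ _))
  | sup _ hs ih =>
    rw [Bldg.mem_Qseq] at ih ⊢
    exact ih.mono fun n hn => (convexResSet_convHull _).1 _ _ hs hn
  | @lim z _ ih =>
    rw [Bldg.mem_Qseq] at ih ⊢
    filter_upwards [ih, hR.eventually_eq z] with n hn h1
    rw [← h1]
    exact (convexResSet_convHull _).2 _ hn _ (subset_convHull _ (Set.mem_insert_of_mem _ rfl))

theorem Qseq_subset {R : ℕ → X.Res} {x z : X.Res} (hz : z ∈ X.Qseq x R) :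
    X.Qseq z R ⊆ X.Qseq x R := by
  intro w hw
  rw [mem_Qseq] at hz hw ⊢
  filter_upwards [hz, hw] with n h1 h2
  refine convHull_subset (convexResSet_convHull _) ?_ h2
  rintro _ (rfl | rfl)
  · exact h1
  · exact subset_convHull _ (Set.mem_insert_of_mem _ rfl)

theorem ConvSeq.exists_hasLim {R : ℕ → X.Res} (h : X.ConvSeq ξ R) :
    ∃ (J : ℕ → Set B) (C : ℕ → X.Chamber), (∀ n, SphType cs (J n)) ∧ X.HasLim J C ξ := by
  choose J C hJ hR using fun n => (R n).2
  refine ⟨J, C, hJ, fun σ => (h.eventually_eq σ).mono fun n hn => ?_⟩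
  rw [← hn, projRes_val, hR]

end Bldg

/-- the family of combinatorial sectors pointing to `ξ ∈ Cr(X)` is
filtering: any two of them contain a common subsector; in particular they have
non-empty intersection. -/
theorem statement12 {cs : CoxeterSystem M W} (X : Bldg cs)
    (ξ : X.Res → X.Res) (hξ : ξ ∈ X.Cr) (hseq : ∃ R : ℕ → X.Res, X.ConvSeq ξ R)
    (x y : X.Res) :
    (∃ z : X.Res, X.Qsector z ξ ⊆ X.Qsector x ξ ∩ X.Qsector y ξ) ∧
    (X.Qsector x ξ ∩ X.Qsector y ξ).Nonempty := by
  have hR := Classical.epsilon_spec hseq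
  obtain ⟨J, C, hJ, H⟩ := hR.exists_hasLim
  obtain ⟨z, hx, hy⟩ := H.exists_common_reach hJ x y
  have hzx : z ∈ X.Qsector x ξ := hx.mem_Qseq hR
  have hzy : z ∈ X.Qsector y ξ := hy.mem_Qseq hR
  exact ⟨⟨z, Set.subset_inter (Bldg.Qseq_subset hzx) (Bldg.Qseq_subset hzy)⟩, z, hzx, hzy⟩
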